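/- arXiv:2407.09278 — 5 statements merged into one kernel-verified Lean document; each statement's English description precedes it below -/
import Mathlib

section
/- Let α ∈ ℝ^d, let v : ℝ^d → ℝ be ℤ^d-periodic and continuous, E ∈ ℝ, k ≥ 1 an integer, and θ ∈ ℝ^d. Let Φ : ℝ^d → SL(2, ℂ) be a map with finite sup-norm ‖Φ‖₀ := sup_x ‖Φ(x)‖, set T̃(x) := Φ(x+α)^{−1} S_E^v(x) Φ(x), let T̃_m(x) := T̃(x+(m−1)α)⋯T̃(x+α)T̃(x) denote its cocycle iterates, and put X̃(x) := Σ_{j=1}^k T̃_{2j−1}(x)* T̃_{2j−1}(x), with entries X̃(x) = [[x̃₁₁, x̃₁₂],[x̃₂₁, x̃₂₂]]. Then: (a) there exists β ∈ (−π/2, π/2] such that ‖Φ‖₀^{−4} · x̃₁₁(θ+α) ≤ ‖u_β^+‖²_{2k} ≤ ‖Φ‖₀^{4} · x̃₁₁(θ+α); (b) ‖Φ‖₀^{−4} ‖X̃(θ+α)‖ ≤ ‖P_{(k),+}(θ)‖ ≤ ‖Φ‖₀^{4} ‖X̃(θ+α)‖; (c) ‖Φ‖₀^{−4} ‖X̃(θ+α)^{−1}‖^{−1}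 ≤ ‖P_{(k),+}(θ)^{−1}‖^{−1} ≤ ‖Φ‖₀^{4} ‖X̃(θ+α)^{−1}‖^{−1}; (d) ‖Φ‖₀^{−8} ‖X̃(θ+α)‖ ‖X̃(θ+α)^{−1}‖^{−1} ≤ det P_{(k),+}(θ) ≤ ‖Φ‖₀^{8} ‖X̃(θ+α)‖ ‖X̃(θ+α)^{−1}‖^{−1}. -/
noncomputable section

/-- Spectral (operator) norm of a 2×2 matrix over an `RCLike` field. -/
def spNorm {𝕜 : Type*} [RCLike 𝕜] (M : Matrix (Fin 2) (Fin 2) 𝕜) : ℝ :=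
  ‖(Matrix.toEuclideanCLM (𝕜 := 𝕜) M : EuclideanSpace 𝕜 (Fin 2) →L[𝕜] EuclideanSpace 𝕜 (Fin 2))‖

/-- Schrödinger cocycle matrix `S_E^v(x)`. -/
def schMat {d : ℕ} (v : (Fin d → ℝ) → ℝ) (E : ℝ) (x : Fin d → ℝ) : Matrix (Fin 2) (Fin 2) ℝ :=
  !![E - v x, -1; 1, 0]

/-- Iterates `A(x+(m−1)α)⋯A(x+α)A(x)` of a quasiperiodic cocycle. -/
def cocIter {d : ℕ} {R : Type*} [Ring R] (α : Fin d → ℝ)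
    (A : (Fin d → ℝ) → Matrix (Fin 2) (Fin 2) R) : ℕ → (Fin d → ℝ) → Matrix (Fin 2) (Fin 2) R
  | 0, _ => 1
  | (m + 1), x => A (x + (m : ℝ) • α) * cocIter α A m x

/-- `P_{(k),+}(θ) = Σ_{j=1}^k 𝒜_{2j−1}(θ+α)* 𝒜_{2j−1}(θ+α)`. -/
def Pplus {d : ℕ} (v : (Fin d → ℝ) → ℝ) (α : Fin d → ℝ) (E : ℝ) (k : ℕ) (θ : Fin d → ℝ) :
    Matrix (Fin 2) (Fin 2) ℝ :=
  ∑ i ∈ Finset.range k,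
    (cocIter α (schMat v E) (2 * i + 1) (θ + α)).transpose *
      cocIter α (schMat v E) (2 * i + 1) (θ + α)

/-- `u` solves the eigenvalue equation `u(n+1) + u(n−1) + v(θ+nα)u(n) = E·u(n)`. -/
def IsSolution {d : ℕ} (v : (Fin d → ℝ) → ℝ) (α θ : Fin d → ℝ) (E : ℝ) (u : ℤ → ℝ) : Prop :=
  ∀ n : ℤ, u (n + 1) + u (n - 1) + v (θ + (n : ℝ) • α) * u n = E * u n

/-- `‖u_β^+‖²_{2k} = Σ_{n=1}^{2k} u(n)²`. -/
def normSqPlus (u : ℤ → ℝ) (k : ℕ) : ℝ := ∑ i ∈ Finset.range (2 * k), u ((i : ℤ) + 1) ^ 2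

section CStarAlgebra

theorem norm_star_mul_mul_le {A : Type*} [CStarAlgebra A] (Q P : A) : ‖star Q * P * Q‖ ≤ ‖Q‖ ^ 2 * ‖P‖ := by
  calc ‖star Q * P * Q‖ ≤ ‖star Q‖ * ‖P‖ * ‖Q‖ := norm_mul₃_le
    _ = ‖Q‖ ^ 2 * ‖P‖ := by rw [norm_star]; ring

variable {A : Type*} [CStarAlgebra A] [PartialOrder A] [StarOrderedRing A]

theorem star_mul_self_le_conj {M : ℝ} {L S R T : A} (hL : ‖L‖ ≤ M) (hT : T = L * S * R) :
    star T * T ≤ star ((M : ℂ) • R) * (star S * S) * ((M : ℂ) • R) := by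
  have h1 : star L * L ≤ algebraMap ℝ A (M ^ 2) :=
    CStarAlgebra.star_mul_le_algebraMap_norm_sq.trans
      (algebraMap_mono A (pow_le_pow_left₀ (norm_nonneg L) hL 2))
  have h2 := star_left_conjugate_le_conjugate h1 (S * R)
  have h3 : star (S * R) * algebraMap ℝ A (M ^ 2) * (S * R) =
      star ((M : ℂ) • R) * (star S * S) * ((M : ℂ) • R) := by
    simp only [Algebra.algebraMap_eq_smul_one, mul_smul_comm, smul_mul_assoc, mul_one, star_smul,
      smul_smul, star_mul, Complex.coe_smul, mul_assoc, star_trivial, sq]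
  rw [← h3]
  refine le_trans (le_of_eq ?_) h2
  simp only [hT, star_mul, mul_assoc]

theorem sum_star_mul_self_le_conj {ι : Type*} (s : Finset ι) {M : ℝ} {R : A} {L S T : ι → A}
    (hL : ∀ i, ‖L i‖ ≤ M) (hT : ∀ i, T i = L i * S i * R) :
    ∑ i ∈ s, star (T i) * T i ≤
      star ((M : ℂ) • R) * (∑ i ∈ s, star (S i) * S i) * ((M : ℂ) • R) := by
  rw [Finset.mul_sum, Finset.sum_mul]
  exact Finset.sum_le_sum fun i _ => star_mul_self_le_conj (hL i) (hT i)

theorem isUnit_sum_star_mul_self {ι : Type*} {s : Finset ι} (hs : s.Nonempty) {T : ι → A}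
    (hT : ∀ i, IsUnit (T i)) : IsUnit (∑ i ∈ s, star (T i) * T i) := by
  obtain ⟨i, hi⟩ := hs
  exact CStarAlgebra.isUnit_of_le (star (T i) * T i)
    (Finset.single_le_sum (f := fun i => star (T i) * T i) (fun j _ => star_mul_self_nonneg (T j)) hi)
    (((hT i).star.mul (hT i)).isStrictlyPositive (star_mul_self_nonneg (T i)))

theorem norm_units_inv_le_of_le_conj {X P Q : Aˣ} (hX : (0 : A) ≤ X)
    (h : (X : A) ≤ star (Q : A) * P * Q) :
    ‖((P⁻¹ : Aˣ) : A)‖ ≤ ‖(Q : A)‖ ^ 2 * ‖((X⁻¹ : Aˣ) : A)‖ := by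
  have h1 : (((star Q * P * Q)⁻¹ : Aˣ) : A) ≤ ((X⁻¹ : Aˣ) : A) :=
    CStarAlgebra.inv_le_inv hX (by simpa using h)
  have hP : (0 : A) ≤ P := by
    have := star_left_conjugate_le_conjugate (hX.trans h) ((Q⁻¹ : Aˣ) : A)
    simpa [mul_assoc, ← Units.coe_star, ← Units.coe_star_inv] using this
  have h2 := star_right_conjugate_le_conjugate h1 (Q : A)
  have h3 : (Q : A) * (((star Q * P * Q)⁻¹ : Aˣ) : A) * star (Q : A) = ((P⁻¹ : Aˣ) : A) := by
    rw [← Units.coe_star, ← Units.val_mul, ← Units.val_mul]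
    congr 1
    group
  rw [h3] at h2
  calc ‖((P⁻¹ : Aˣ) : A)‖ ≤ ‖(Q : A) * ((X⁻¹ : Aˣ) : A) * star (Q : A)‖ :=
        CStarAlgebra.norm_le_norm_of_nonneg_of_le
          (by simpa using CFC.inv_nonneg_of_nonneg P hP) h2
    _ ≤ ‖star (Q : A)‖ ^ 2 * ‖((X⁻¹ : Aˣ) : A)‖ := by
        simpa using norm_star_mul_mul_le (star (Q : A)) ((X⁻¹ : Aˣ) : A)
    _ = _ := by rw [norm_star]

end CStarAlgebra

section MatrixNorm

open scoped Matrix.Norms.L2Operator Matrix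

variable {𝕜 : Type*} [RCLike 𝕜]

theorem spNorm_eq_norm (M : Matrix (Fin 2) (Fin 2) 𝕜) : spNorm M = ‖M‖ := rfl

theorem sq_norm_apply_le (M : Matrix (Fin 2) (Fin 2) 𝕜) (a b : 𝕜) :
    ‖M 0 0 * a + M 0 1 * b‖ ^ 2 + ‖M 1 0 * a + M 1 1 * b‖ ^ 2 ≤
      spNorm M ^ 2 * (‖a‖ ^ 2 + ‖b‖ ^ 2) := by
  have h := (Matrix.toEuclideanCLM (n := Fin 2) (𝕜 := 𝕜) M).le_opNorm !₂[a, b]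
  have h2 := pow_le_pow_left₀ (norm_nonneg _) h 2
  rw [mul_pow, EuclideanSpace.norm_sq_eq, EuclideanSpace.norm_sq_eq] at h2
  simpa [Matrix.mulVec, dotProduct, Fin.sum_univ_two, spNorm] using h2

theorem spNorm_le_of_sq_norm_apply_le {M : Matrix (Fin 2) (Fin 2) 𝕜} {c : ℝ} (hc : 0 ≤ c)
    (h : ∀ a b : 𝕜, ‖M 0 0 * a + M 0 1 * b‖ ^ 2 + ‖M 1 0 * a + M 1 1 * b‖ ^ 2 ≤
      c ^ 2 * (‖a‖ ^ 2 + ‖b‖ ^ 2)) : spNorm M ≤ c := by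
  refine ContinuousLinearMap.opNorm_le_bound _ hc fun x => ?_
  refine (sq_le_sq₀ (norm_nonneg _) (by positivity)).1 ?_
  rw [mul_pow, EuclideanSpace.norm_sq_eq, EuclideanSpace.norm_sq_eq]
  simpa [Matrix.mulVec, dotProduct, Fin.sum_univ_two] using h (x 0) (x 1)

theorem spNorm_nonneg (M : Matrix (Fin 2) (Fin 2) 𝕜) : 0 ≤ spNorm M := norm_nonneg _

theorem spNorm_map_ofReal (P : Matrix (Fin 2) (Fin 2) ℝ) :
    spNorm (P.map Complex.ofReal) = spNorm P := by
  refine le_antisymm (spNorm_le_of_sq_norm_apply_le (spNorm_nonneg _) fun a b => ?_)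
    (spNorm_le_of_sq_norm_apply_le (spNorm_nonneg _) fun a b => ?_)
  · have h1 := sq_norm_apply_le P a.re b.re
    have h2 := sq_norm_apply_le P a.im b.im
    simp only [Real.norm_eq_abs, sq_abs] at h1 h2
    simp only [Complex.sq_norm, Complex.normSq_apply, Matrix.map_apply, Complex.add_re,
      Complex.add_im, Complex.re_ofReal_mul, Complex.im_ofReal_mul]
    linarith
  · have h := sq_norm_apply_le (P.map Complex.ofReal) a b
    simp only [Matrix.map_apply, ← Complex.ofReal_mul, ← Complex.ofReal_add,
      Complex.norm_real] at h
    exact h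

theorem spNorm_adjugate_le (M : Matrix (Fin 2) (Fin 2) 𝕜) : spNorm M.adjugate ≤ spNorm M := by
  refine spNorm_le_of_sq_norm_apply_le (spNorm_nonneg _) fun a b => ?_
  have h := sq_norm_apply_le Mᴴ (star b) (-star a)
  have h1 : ‖Mᴴ 0 0 * star b + Mᴴ 0 1 * -star a‖ = ‖-M 1 0 * a + M 0 0 * b‖ := by
    rw [← norm_star (-M 1 0 * a + M 0 0 * b)]
    congr 1
    simp [mul_comm, add_comm]
  have h2 : ‖Mᴴ 1 0 * star b + Mᴴ 1 1 * -star a‖ = ‖M 1 1 * a + -M 0 1 * b‖ := by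
    rw [← norm_star (M 1 1 * a + -M 0 1 * b), ← norm_neg]
    congr 1
    simp [mul_comm]
  rw [h1, h2, norm_neg, norm_star, norm_star, spNorm_eq_norm,
    Matrix.l2_opNorm_conjTranspose] at h
  simp only [Matrix.adjugate_fin_two, Matrix.of_apply, Matrix.cons_val]
  rw [spNorm_eq_norm]
  linarith

theorem spNorm_adjugate (M : Matrix (Fin 2) (Fin 2) 𝕜) : spNorm M.adjugate = spNorm M := by
  refine le_antisymm (spNorm_adjugate_le M) ?_
  have h : M.adjugate.adjugate = M := by
    simp [Matrix.adjugate_fin_two, ← Matrix.eta_fin_two M]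
  simpa only [h] using spNorm_adjugate_le M.adjugate

theorem spNorm_inv_of_det_eq_one {M : Matrix (Fin 2) (Fin 2) 𝕜} (hM : M.det = 1) :
    spNorm M⁻¹ = spNorm M := by
  rw [Matrix.inv_def, hM, Ring.inverse_one, one_smul, spNorm_adjugate]

theorem spNorm_mul_inv_spNorm_inv {P : Matrix (Fin 2) (Fin 2) ℝ} (hP : 0 < P.det) :
    spNorm P * (spNorm P⁻¹)⁻¹ = P.det := by
  have h : spNorm P⁻¹ = P.det⁻¹ * spNorm P := by
    rw [Matrix.inv_def, spNorm_eq_norm, norm_smul, ← spNorm_eq_norm, spNorm_adjugate,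
      Ring.inverse_eq_inv', Real.norm_of_nonneg (inv_nonneg.2 hP.le)]
  have h0 : spNorm P ≠ 0 := by
    rw [spNorm_eq_norm, norm_ne_zero_iff]
    rintro rfl
    simp at hP
  rw [h]
  field_simp

end MatrixNorm

section Comparison

open scoped Matrix.Norms.L2Operator MatrixOrder Matrix ComplexOrder

theorem norm_smul_sq_le {M : ℝ} {R : Matrix (Fin 2) (Fin 2) ℂ} (hR : spNorm R ≤ M) :
    ‖(M : ℂ) • R‖ ^ 2 ≤ M ^ 4 := by
  have h0 : 0 ≤ spNorm R := spNorm_nonneg R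
  rw [norm_smul, Complex.norm_real, Real.norm_of_nonneg (h0.trans hR), ← spNorm_eq_norm]
  calc (M * spNorm R) ^ 2 ≤ (M * M) ^ 2 := by
        have := h0.trans hR
        gcongr
    _ = M ^ 4 := by ring

theorem spNorm_le_of_le_conj {M : ℝ} {X P R : Matrix (Fin 2) (Fin 2) ℂ} (hX : 0 ≤ X)
    (hR : spNorm R ≤ M) (h : X ≤ star ((M : ℂ) • R) * P * ((M : ℂ) • R)) :
    spNorm X ≤ M ^ 4 * spNorm P :=
  ((CStarAlgebra.norm_le_norm_of_nonneg_of_le hX h).trans (norm_star_mul_mul_le _ _)).trans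
    (mul_le_mul_of_nonneg_right (norm_smul_sq_le hR) (norm_nonneg P))

theorem spNorm_inv_le_of_le_conj {M : ℝ} (hM : 0 < M) {X P R : Matrix (Fin 2) (Fin 2) ℂ}
    (hX : 0 ≤ X) (hXu : IsUnit X) (hPu : IsUnit P) (hRu : IsUnit R) (hR : spNorm R ≤ M)
    (h : X ≤ star ((M : ℂ) • R) * P * ((M : ℂ) • R)) :
    spNorm P⁻¹ ≤ M ^ 4 * spNorm X⁻¹ := by
  have hQu : IsUnit ((M : ℂ) • R) := by
    have := hRu.smul (Units.mk0 (M : ℂ) (by exact_mod_cast hM.ne'))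
    simpa [Units.smul_def] using this
  obtain ⟨x, rfl⟩ := hXu
  obtain ⟨p, rfl⟩ := hPu
  obtain ⟨q, hq⟩ := hQu
  rw [← hq] at h
  have h1 := norm_units_inv_le_of_le_conj hX h
  rw [Matrix.coe_units_inv, Matrix.coe_units_inv, hq] at h1
  exact h1.trans (mul_le_mul_of_nonneg_right (norm_smul_sq_le hR) (norm_nonneg _))

theorem re_apply_zero_zero_mono {X Y : Matrix (Fin 2) (Fin 2) ℂ} (h : X ≤ Y) :
    (X 0 0).re ≤ (Y 0 0).re := by
  have h1 := (Matrix.le_iff.1 h).diag_nonneg (i := 0)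
  have h2 := (Complex.le_def.1 h1).1
  simpa using h2

theorem star_smul_mul_mul_smul (M : ℝ) (P R : Matrix (Fin 2) (Fin 2) ℂ) :
    star ((M : ℂ) • R) * P * ((M : ℂ) • R) = (M ^ 2 : ℝ) • (star R * P * R) := by
  simp [star_smul, smul_smul, sq]

theorem re_conj_apply_zero_zero_le {M : ℝ} {X P R : Matrix (Fin 2) (Fin 2) ℂ}
    (h : X ≤ star ((M : ℂ) • R) * P * ((M : ℂ) • R)) :
    (X 0 0).re ≤ M ^ 2 * ((star R * P * R) 0 0).re := by
  rw [star_smul_mul_mul_smul] at h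
  simpa [← Complex.ofReal_pow] using re_apply_zero_zero_mono h

theorem re_conj_apply_zero_zero_le' {M : ℝ} {X P R R' : Matrix (Fin 2) (Fin 2) ℂ}
    (hR : R' * R = 1) (h : P ≤ star ((M : ℂ) • R') * X * ((M : ℂ) • R')) :
    ((star R * P * R) 0 0).re ≤ M ^ 2 * (X 0 0).re := by
  have h1 := star_left_conjugate_le_conjugate h R
  have h2 : star R * (star ((M : ℂ) • R') * X * ((M : ℂ) • R')) * R = (M ^ 2 : ℝ) • X := by
    rw [star_smul_mul_mul_smul, mul_smul_comm, smul_mul_assoc]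
    congr 1
    calc star R * (star R' * X * R') * R = star (R' * R) * X * (R' * R) := by
          simp only [star_mul, mul_assoc]
      _ = X := by simp [hR]
  rw [h2] at h1
  simpa [← Complex.ofReal_pow] using re_apply_zero_zero_mono h1

theorem re_star_mul_map_ofReal_mul_apply_zero_zero (P : Matrix (Fin 2) (Fin 2) ℝ)
    (R : Matrix (Fin 2) (Fin 2) ℂ) :
    ((star R * P.map Complex.ofReal * R) 0 0).re =
      P 0 0 * ((R 0 0).re ^ 2 + (R 0 0).im ^ 2) +
      (P 0 1 + P 1 0) * ((R 0 0).re * (R 1 0).re + (R 0 0).im * (R 1 0).im) +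
      P 1 1 * ((R 1 0).re ^ 2 + (R 1 0).im ^ 2) := by
  simp [Matrix.mul_apply, Fin.sum_univ_two, Matrix.star_apply]
  ring

theorem normSq_column_le {M : ℝ} {R : Matrix (Fin 2) (Fin 2) ℂ} (hR : spNorm R ≤ M) :
    (R 0 0).re ^ 2 + (R 0 0).im ^ 2 + ((R 1 0).re ^ 2 + (R 1 0).im ^ 2) ≤ M ^ 2 := by
  have h := sq_norm_apply_le R 1 0
  simp only [mul_one, mul_zero, add_zero, Complex.sq_norm, Complex.normSq_apply, Complex.one_re,
    Complex.one_im, Complex.zero_re, Complex.zero_im] at h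
  nlinarith [pow_le_pow_left₀ (spNorm_nonneg R) hR 2]

theorem one_le_normSq_column {M : ℝ} {R : Matrix (Fin 2) (Fin 2) ℂ} (hdet : R.det = 1)
    (hR : spNorm R ≤ M) :
    1 ≤ M ^ 2 *
      ((R 0 0).re ^ 2 + (R 0 0).im ^ 2 + ((R 1 0).re ^ 2 + (R 1 0).im ^ 2)) := by
  have h := sq_norm_apply_le R.adjugate (R 0 0) (R 1 0)
  have h0 : R.adjugate 0 0 * R 0 0 + R.adjugate 0 1 * R 1 0 = 1 := by
    rw [← hdet, Matrix.det_fin_two, Matrix.adjugate_fin_two]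
    simp
    ring
  have h1 : R.adjugate 1 0 * R 0 0 + R.adjugate 1 1 * R 1 0 = 0 := by
    rw [Matrix.adjugate_fin_two]
    simp
    ring
  rw [h0, h1, spNorm_adjugate] at h
  simp only [Complex.sq_norm, Complex.normSq_apply, Complex.one_re,
    Complex.one_im, Complex.zero_re, Complex.zero_im] at h
  have h2 := mul_le_mul_of_nonneg_right (pow_le_pow_left₀ (spNorm_nonneg R) hR 2)
    (show 0 ≤ (R 0 0).re ^ 2 + (R 0 0).im ^ 2 + ((R 1 0).re ^ 2 + (R 1 0).im ^ 2) by positivity)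
  linarith

end Comparison

section QuadraticForm

open Real

theorem exists_polar (x y : ℝ) :
    ∃ t : ℝ, x = √(x ^ 2 + y ^ 2) * cos t ∧ y = -(√(x ^ 2 + y ^ 2) * sin t) := by
  refine ⟨Complex.arg ⟨x, -y⟩, ?_⟩
  have hn : ‖(⟨x, -y⟩ : ℂ)‖ = √(x ^ 2 + y ^ 2) := by
    rw [Complex.norm_def, Complex.normSq_mk]
    ring_nf
  rw [← hn, Complex.norm_mul_cos_arg, Complex.norm_mul_sin_arg]
  simp

theorem exists_angle_quadratic_form_eq (A B C x₁ y₁ x₂ y₂ : ℝ) :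
    ∃ β ∈ Set.Ioc (-(π / 2)) (π / 2),
      A * (x₁ ^ 2 + x₂ ^ 2) + B * (x₁ * y₁ + x₂ * y₂) + C * (y₁ ^ 2 + y₂ ^ 2) =
        (x₁ ^ 2 + x₂ ^ 2 + (y₁ ^ 2 + y₂ ^ 2)) *
          (A * cos β ^ 2 + B * (-(sin β * cos β)) + C * sin β ^ 2) := by
  set f : ℝ → ℝ := fun t => A * cos t ^ 2 + B * (-(sin t * cos t)) + C * sin t ^ 2 with hf
  have hper : Function.Periodic f π := fun t => by simp [hf]
  have hcont : Continuous f := by fun_prop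
  obtain ⟨t₁, hx₁, hy₁⟩ := exists_polar x₁ y₁
  obtain ⟨t₂, hx₂, hy₂⟩ := exists_polar x₂ y₂
  set r₁ := √(x₁ ^ 2 + y₁ ^ 2)
  set r₂ := √(x₂ ^ 2 + y₂ ^ 2)
  have hlhs : A * (x₁ ^ 2 + x₂ ^ 2) + B * (x₁ * y₁ + x₂ * y₂) + C * (y₁ ^ 2 + y₂ ^ 2) =
      r₁ ^ 2 * f t₁ + r₂ ^ 2 * f t₂ := by
    rw [hx₁, hx₂, hy₁, hy₂]
    simp only [hf]
    ring
  have hsum : x₁ ^ 2 + x₂ ^ 2 + (y₁ ^ 2 + y₂ ^ 2) = r₁ ^ 2 + r₂ ^ 2 := by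
    rw [Real.sq_sqrt (by positivity), Real.sq_sqrt (by positivity)]
    ring
  obtain ⟨t, ht⟩ : ∃ t, r₁ ^ 2 * f t₁ + r₂ ^ 2 * f t₂ = (r₁ ^ 2 + r₂ ^ 2) * f t := by
    rcases (add_nonneg (sq_nonneg r₁) (sq_nonneg r₂)).eq_or_lt with h0 | h0
    · have h1 : r₁ ^ 2 = 0 := by nlinarith [sq_nonneg r₁, sq_nonneg r₂]
      have h2 : r₂ ^ 2 = 0 := by nlinarith [sq_nonneg r₁, sq_nonneg r₂]
      exact ⟨0, by simp [h1, h2]⟩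
    · have hmem : (r₁ ^ 2 + r₂ ^ 2)⁻¹ * (r₁ ^ 2 * f t₁ + r₂ ^ 2 * f t₂) ∈ Set.range f := by
        refine (isPreconnected_range hcont).ordConnected.uIcc_subset
          (Set.mem_range_self t₁) (Set.mem_range_self t₂) ?_
        rw [← segment_eq_uIcc]
        refine ⟨r₁ ^ 2 / (r₁ ^ 2 + r₂ ^ 2), r₂ ^ 2 / (r₁ ^ 2 + r₂ ^ 2), by positivity,
          by positivity, by field_simp, ?_⟩
        simp only [smul_eq_mul]
        field_simp
      obtain ⟨t, ht⟩ := hmem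
      exact ⟨t, by rw [ht]; field_simp⟩
  refine ⟨toIocMod pi_pos (-(π / 2)) t, ?_, ?_⟩
  · have := toIocMod_mem_Ioc pi_pos (-(π / 2)) t
    rwa [show -(π / 2) + π = π / 2 by ring] at this
  · rw [hlhs, hsum, ht]
    congr 1
    change f t = f (toIocMod pi_pos (-(π / 2)) t)
    rw [← self_sub_toIocDiv_zsmul, hper.sub_zsmul_eq]

theorem quadratic_form_of_boundary_condition {a b β : ℝ} (hβ : a * cos β + b * sin β = 0)
    (hab : a ^ 2 + b ^ 2 = 1) :
    b ^ 2 = cos β ^ 2 ∧ b * a = -(sin β * cos β) ∧ a ^ 2 = sin β ^ 2 := by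
  have h := sin_sq_add_cos_sq β
  refine ⟨?_, ?_, ?_⟩
  · linear_combination (-b ^ 2) * h + (b * sin β - a * cos β) * hβ + cos β ^ 2 * hab
  · linear_combination (-(b * a)) * h + (a * sin β + b * cos β) * hβ - sin β * cos β * hab
  · linear_combination (-a ^ 2) * h + (a * cos β - b * sin β) * hβ + sin β ^ 2 * hab

end QuadraticForm

section Cocycle

open Matrix

variable {d : ℕ} {v : (Fin d → ℝ) → ℝ} {α θ : Fin d → ℝ} {E : ℝ}

theorem det_cocIter_schMat (m : ℕ) (x : Fin d → ℝ) : (cocIter α (schMat v E) m x).det = 1 := by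
  induction m with
  | zero => simp [cocIter]
  | succ m ih => rw [cocIter, det_mul, ih, schMat, det_fin_two_of]; norm_num

theorem cocIter_conj {Φ : (Fin d → ℝ) → Matrix (Fin 2) (Fin 2) ℂ} (hΦ : ∀ x, (Φ x).det = 1)
    (m : ℕ) (x : Fin d → ℝ) :
    cocIter α (fun x => (Φ (x + α))⁻¹ * (schMat v E x).map Complex.ofReal * Φ x) m x =
      (Φ (x + (m : ℝ) • α))⁻¹ * (cocIter α (schMat v E) m x).map Complex.ofReal * Φ x := by
  have hu : ∀ x, IsUnit (Φ x).det := fun x => by simp [hΦ x]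
  induction m with
  | zero =>
    have h1 : (1 : Matrix (Fin 2) (Fin 2) ℝ).map Complex.ofReal = 1 :=
      Matrix.map_one _ Complex.ofReal_zero Complex.ofReal_one
    simp [cocIter, h1, nonsing_inv_mul _ (hu x)]
  | succ m ih =>
    have hmap : (schMat v E (x + (m : ℝ) • α) * cocIter α (schMat v E) m x).map Complex.ofReal =
        (schMat v E (x + (m : ℝ) • α)).map Complex.ofReal *
          (cocIter α (schMat v E) m x).map Complex.ofReal :=
      Matrix.map_mul (f := Complex.ofRealHom)
    have hx : x + (m : ℝ) • α + α = x + ((m + 1 : ℕ) : ℝ) • α := by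
      push_cast
      rw [add_smul, one_smul, add_assoc]
    simp only [cocIter]
    rw [ih, hmap, hx]
    simp only [mul_assoc]
    rw [mul_nonsing_inv_cancel_left _ _ (hu _)]

theorem cocIter_schMat_mulVec {u : ℤ → ℝ} (hu : IsSolution v α θ E u) (m : ℕ) :
    cocIter α (schMat v E) m (θ + α) *ᵥ ![u 1, u 0] = ![u (m + 1), u m] := by
  induction m with
  | zero => simp [cocIter]
  | succ m ih =>
    have hx : θ + α + (m : ℝ) • α = θ + ((m + 1 : ℤ) : ℝ) • α := by
      push_cast
      rw [add_smul, one_smul]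
      abel
    have h := hu (m + 1)
    rw [cocIter, ← mulVec_mulVec, ih, hx]
    ext i
    fin_cases i
    · simp [schMat, mulVec, dotProduct] at h ⊢
      linarith
    · simp [schMat, mulVec, dotProduct]

theorem sum_range_two_mul {R : Type*} [AddCommMonoid R] (f : ℕ → R) (k : ℕ) :
    ∑ i ∈ Finset.range (2 * k), f i = ∑ i ∈ Finset.range k, (f (2 * i) + f (2 * i + 1)) := by
  induction k with
  | zero => simp
  | succ k ih =>
    rw [Finset.sum_range_succ, ← ih, mul_add_one, Finset.sum_range_succ, Finset.sum_range_succ,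
      add_assoc]

theorem normSqPlus_eq_quadratic_form {u : ℤ → ℝ} (hu : IsSolution v α θ E u) (k : ℕ) :
    normSqPlus u k = Pplus v α E k θ 0 0 * u 1 ^ 2 +
      (Pplus v α E k θ 0 1 + Pplus v α E k θ 1 0) * (u 1 * u 0) +
      Pplus v α E k θ 1 1 * u 0 ^ 2 := by
  rw [normSqPlus, sum_range_two_mul]
  simp only [Pplus, Matrix.sum_apply, ← Finset.sum_add_distrib, Finset.sum_mul]
  refine Finset.sum_congr rfl fun i _ => ?_
  have h := cocIter_schMat_mulVec hu (2 * i + 1)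
  have h0 := congrFun h 0
  have h1 := congrFun h 1
  simp [mulVec, dotProduct, Fin.sum_univ_two] at h0 h1
  simp [mul_apply, Fin.sum_univ_two]
  rw [← h0, ← h1]
  ring

theorem Pplus_map_ofReal (k : ℕ) :
    (Pplus v α E k θ).map Complex.ofReal = ∑ i ∈ Finset.range k,
      star ((cocIter α (schMat v E) (2 * i + 1) (θ + α)).map Complex.ofReal) *
        (cocIter α (schMat v E) (2 * i + 1) (θ + α)).map Complex.ofReal := by
  ext a b
  simp [Pplus, Matrix.sum_apply, mul_apply, Matrix.star_apply]

theorem det_map_ofReal (P : Matrix (Fin 2) (Fin 2) ℝ) :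
    (P.map Complex.ofReal).det = P.det :=
  (RingHom.map_det Complex.ofRealHom P).symm

theorem isUnit_map_cocIter_schMat (m : ℕ) (x : Fin d → ℝ) :
    IsUnit ((cocIter α (schMat v E) m x).map Complex.ofReal) := by
  rw [isUnit_iff_isUnit_det, det_map_ofReal, det_cocIter_schMat]
  simp

theorem map_ofReal_inv (P : Matrix (Fin 2) (Fin 2) ℝ) :
    P⁻¹.map Complex.ofReal = (P.map Complex.ofReal)⁻¹ := by
  ext i j
  rw [inv_def, inv_def, det_map_ofReal, adjugate_fin_two, adjugate_fin_two]
  fin_cases i <;> fin_cases j <;> simp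

theorem Pplus_posSemidef (k : ℕ) : (Pplus v α E k θ).PosSemidef :=
  posSemidef_sum _ fun i _ => by
    simpa using posSemidef_conjTranspose_mul_self (cocIter α (schMat v E) (2 * i + 1) (θ + α))

end Cocycle

open scoped Matrix.Norms.L2Operator MatrixOrder

/-- comparison of `P_{(k),+}` and `‖u_β^+‖²_{2k}` with the conjugated
cocycle sums `X̃` (Lemma `P_kX`). -/
theorem Pk_vs_conjugated_sums
    (d : ℕ) (α : Fin d → ℝ)
    (v : (Fin d → ℝ) → ℝ) (hvper : ∀ (x : Fin d → ℝ) (m : Fin d → ℤ),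
      v (x + fun i => (m i : ℝ)) = v x) (hvcont : Continuous v)
    (E : ℝ) (k : ℕ) (hk : 1 ≤ k) (θ : Fin d → ℝ)
    (Φ : (Fin d → ℝ) → Matrix (Fin 2) (Fin 2) ℂ)
    (hΦdet : ∀ x, (Φ x).det = 1)
    (hΦbdd : BddAbove (Set.range fun x => spNorm (Φ x))) :
    -- abbreviations (via lets) for `T̃`, its iterates, `X̃` and `‖Φ‖₀`:
    letI Ttil : (Fin d → ℝ) → Matrix (Fin 2) (Fin 2) ℂ :=
      fun x => (Φ (x + α))⁻¹ * (schMat v E x).map Complex.ofReal * Φ x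
    letI Xtil : (Fin d → ℝ) → Matrix (Fin 2) (Fin 2) ℂ :=
      fun x => ∑ i ∈ Finset.range k,
        (cocIter α Ttil (2 * i + 1) x).conjTranspose * cocIter α Ttil (2 * i + 1) x
    letI M : ℝ := ⨆ x, spNorm (Φ x)
    -- (a) there exists `β` such that `‖u_β^+‖²_{2k}` is comparable to `x̃₁₁(θ+α)`:
    (∃ β ∈ Set.Ioc (-(Real.pi / 2)) (Real.pi / 2), ∀ u : ℤ → ℝ,
      IsSolution v α θ E u → u 0 * Real.cos β + u 1 * Real.sin β = 0 →
      u 0 ^ 2 + u 1 ^ 2 = 1 →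
        (Xtil (θ + α) 0 0).re / M ^ 4 ≤ normSqPlus u k ∧
        normSqPlus u k ≤ M ^ 4 * (Xtil (θ + α) 0 0).re) ∧
    -- (b) `‖P_{(k),+}‖` is comparable to `‖X̃(θ+α)‖`:
    (spNorm (Xtil (θ + α)) / M ^ 4 ≤ spNorm (Pplus v α E k θ) ∧
      spNorm (Pplus v α E k θ) ≤ M ^ 4 * spNorm (Xtil (θ + α))) ∧
    -- (c) `‖P_{(k),+}⁻¹‖⁻¹` is comparable to `‖X̃(θ+α)⁻¹‖⁻¹`:
    ((spNorm ((Xtil (θ + α))⁻¹))⁻¹ / M ^ 4 ≤ (spNorm ((Pplus v α E k θ)⁻¹))⁻¹ ∧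
      (spNorm ((Pplus v α E k θ)⁻¹))⁻¹ ≤ M ^ 4 * (spNorm ((Xtil (θ + α))⁻¹))⁻¹) ∧
    -- (d) `det P_{(k),+}` is comparable to `‖X̃(θ+α)‖·‖X̃(θ+α)⁻¹‖⁻¹`:
    (spNorm (Xtil (θ + α)) * (spNorm ((Xtil (θ + α))⁻¹))⁻¹ / M ^ 8 ≤
        (Pplus v α E k θ).det ∧
      (Pplus v α E k θ).det ≤
        M ^ 8 * (spNorm (Xtil (θ + α)) * (spNorm ((Xtil (θ + α))⁻¹))⁻¹)) := by
  set M : ℝ := ⨆ x, spNorm (Φ x)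
  have hnorm : ∀ x, spNorm (Φ x) ≤ M := fun x => le_ciSup hΦbdd x
  have hnorm' : ∀ x, spNorm (Φ x)⁻¹ ≤ M := fun x =>
    (spNorm_inv_of_det_eq_one (hΦdet x)).trans_le (hnorm x)
  have hu : ∀ x, IsUnit (Φ x).det := fun x => by simp [hΦdet x]
  have hΦu : ∀ x, IsUnit (Φ x) := fun x => (Matrix.isUnit_iff_isUnit_det _).2 (hu x)
  set T : ℕ → Matrix (Fin 2) (Fin 2) ℂ := fun i =>
    cocIter α (fun x => (Φ (x + α))⁻¹ * (schMat v E x).map Complex.ofReal * Φ x) (2 * i + 1)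
      (θ + α)
  set S : ℕ → Matrix (Fin 2) (Fin 2) ℂ := fun i =>
    (cocIter α (schMat v E) (2 * i + 1) (θ + α)).map Complex.ofReal
  set L : ℕ → Matrix (Fin 2) (Fin 2) ℂ := fun i => Φ (θ + α + ((2 * i + 1 : ℕ) : ℝ) • α)
  set R : Matrix (Fin 2) (Fin 2) ℂ := Φ (θ + α)
  have hT : ∀ i, T i = (L i)⁻¹ * S i * R := fun i => cocIter_conj hΦdet _ _
  have hS : ∀ i, S i = L i * T i * R⁻¹ := fun i => by
    rw [hT, mul_assoc, mul_assoc, Matrix.mul_nonsing_inv R (hu _), mul_one,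
      Matrix.mul_nonsing_inv_cancel_left _ _ (hu _)]
  set X : Matrix (Fin 2) (Fin 2) ℂ := ∑ i ∈ Finset.range k, star (T i) * T i
  set P : Matrix (Fin 2) (Fin 2) ℝ := Pplus v α E k θ
  set Pc : Matrix (Fin 2) (Fin 2) ℂ := P.map Complex.ofReal with hPcdef
  have hPc : Pc = ∑ i ∈ Finset.range k, star (S i) * S i := Pplus_map_ofReal k
  have hXP : X ≤ star ((M : ℂ) • R) * Pc * ((M : ℂ) • R) := by
    rw [hPc]
    exact sum_star_mul_self_le_conj _ (fun i => hnorm' _) hT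
  have hPX : Pc ≤ star ((M : ℂ) • R⁻¹) * X * ((M : ℂ) • R⁻¹) := by
    rw [hPc]
    exact sum_star_mul_self_le_conj _ (fun i => hnorm _) hS
  have hX0 : 0 ≤ X := Finset.sum_nonneg fun i _ => star_mul_self_nonneg (T i)
  have hP0 : 0 ≤ Pc := hPc ▸ Finset.sum_nonneg fun i _ => star_mul_self_nonneg (S i)
  have hrange : (Finset.range k).Nonempty := Finset.nonempty_range_iff.2 (by omega)
  have hSu : ∀ i, IsUnit (S i) := fun i => isUnit_map_cocIter_schMat _ _
  have hRu' : IsUnit R⁻¹ := (Matrix.isUnit_nonsing_inv_iff).2 (hΦu _)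
  have hTu : ∀ i, IsUnit (T i) := fun i => by
    rw [hT]
    exact ((Matrix.isUnit_nonsing_inv_iff.2 (hΦu _)).mul (hSu i)).mul (hΦu _)
  have hXu : IsUnit X := isUnit_sum_star_mul_self hrange hTu
  have hPu : IsUnit Pc := hPc ▸ isUnit_sum_star_mul_self hrange hSu
  have hcol := one_le_normSq_column (hΦdet (θ + α)) (hnorm (θ + α))
  have hcol' := normSq_column_le (hnorm (θ + α))
  have hM : 0 < M := by
    refine lt_of_le_of_ne ((spNorm_nonneg _).trans (hnorm 0)) fun h => ?_
    rw [← h] at hcol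
    norm_num at hcol
  have hdet : 0 < P.det := by
    refine lt_of_le_of_ne (Pplus_posSemidef k).det_nonneg fun h => ?_
    have := (Matrix.isUnit_iff_isUnit_det _).1 hPu
    rw [hPcdef, det_map_ofReal, ← h] at this
    simp at this
  have hb1 : spNorm X ≤ M ^ 4 * spNorm P := by
    simpa only [hPcdef, spNorm_map_ofReal] using spNorm_le_of_le_conj hX0 (hnorm _) hXP
  have hb2 : spNorm P ≤ M ^ 4 * spNorm X := by
    simpa only [hPcdef, spNorm_map_ofReal] using spNorm_le_of_le_conj hP0 (hnorm' _) hPX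
  have hc1 : spNorm P⁻¹ ≤ M ^ 4 * spNorm X⁻¹ := by
    simpa only [hPcdef, ← map_ofReal_inv, spNorm_map_ofReal] using
      spNorm_inv_le_of_le_conj hM hX0 hXu hPu (hΦu _) (hnorm _) hXP
  have hc2 : spNorm X⁻¹ ≤ M ^ 4 * spNorm P⁻¹ := by
    simpa only [hPcdef, ← map_ofReal_inv, spNorm_map_ofReal] using
      spNorm_inv_le_of_le_conj hM hP0 hPu hXu hRu' (hnorm' _) hPX
  have hpos : ∀ {a b : ℝ}, 0 < a → a ≤ M ^ 4 * b → 0 < b := fun ha hab =>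
    (mul_pos_iff_of_pos_left (by positivity)).1 (ha.trans_le hab)
  have hPinv : 0 < spNorm P⁻¹ := by
    refine (spNorm_nonneg _).lt_of_ne' fun h => ?_
    have := spNorm_mul_inv_spNorm_inv hdet
    rw [h, inv_zero, mul_zero] at this
    exact hdet.ne this
  have hXinv : 0 < spNorm X⁻¹ := hpos hPinv hc1
  have hc3 : (spNorm X⁻¹)⁻¹ / M ^ 4 ≤ (spNorm P⁻¹)⁻¹ := by
    rw [div_le_iff₀ (by positivity), inv_le_iff_one_le_mul₀ hXinv]
    field_simp
    linarith
  have hc4 : (spNorm P⁻¹)⁻¹ ≤ M ^ 4 * (spNorm X⁻¹)⁻¹ := by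
    rw [inv_le_iff_one_le_mul₀ hPinv]
    field_simp
    linarith
  refine ⟨?_, ⟨(div_le_iff₀' (by positivity)).2 hb1, hb2⟩, ⟨hc3, hc4⟩, ?_, ?_⟩
  · obtain ⟨β, hβ, hform⟩ := exists_angle_quadratic_form_eq (P 0 0) (P 0 1 + P 1 0) (P 1 1)
      (R 0 0).re (R 1 0).re (R 0 0).im (R 1 0).im
    refine ⟨β, hβ, fun u hsol hbc hone => ?_⟩
    obtain ⟨h1, h2, h3⟩ := quadratic_form_of_boundary_condition hbc hone
    have hN := normSqPlus_eq_quadratic_form hsol k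
    rw [h1, h2, h3] at hN
    rw [← hN, ← re_star_mul_map_ofReal_mul_apply_zero_zero] at hform
    have hN0 : 0 ≤ normSqPlus u k := Finset.sum_nonneg fun i _ => sq_nonneg _
    have hle := re_conj_apply_zero_zero_le hXP
    have hge := re_conj_apply_zero_zero_le' (Matrix.nonsing_inv_mul _ (hu (θ + α))) hPX
    rw [hform] at hle hge
    change (X 0 0).re / M ^ 4 ≤ normSqPlus u k ∧ normSqPlus u k ≤ M ^ 4 * (X 0 0).re
    have hM2 : 0 ≤ M ^ 2 := by positivity
    have h4 := mul_le_mul_of_nonneg_left (mul_le_mul_of_nonneg_right hcol' hN0) hM2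
    have h5 := mul_le_mul_of_nonneg_left hge hM2
    have h6 := mul_le_mul_of_nonneg_right hcol hN0
    constructor
    · rw [div_le_iff₀ (by positivity)]
      linarith
    · linarith
  · change spNorm X * (spNorm X⁻¹)⁻¹ / M ^ 8 ≤ P.det
    rw [← spNorm_mul_inv_spNorm_inv hdet]
    calc spNorm X * (spNorm X⁻¹)⁻¹ / M ^ 8 = spNorm X / M ^ 4 * ((spNorm X⁻¹)⁻¹ / M ^ 4) := by
          field_simp
      _ ≤ _ := mul_le_mul ((div_le_iff₀' (by positivity)).2 hb1) hc3 (by positivity)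
          (spNorm_nonneg _)
  · change P.det ≤ M ^ 8 * (spNorm X * (spNorm X⁻¹)⁻¹)
    rw [← spNorm_mul_inv_spNorm_inv hdet]
    calc _ ≤ M ^ 4 * spNorm X * (M ^ 4 * (spNorm X⁻¹)⁻¹) :=
          mul_le_mul hb2 hc4 (by positivity) ((spNorm_nonneg _).trans hb2)
      _ = _ := by ring
end
end

section
/- With the piecewise function ψ as defined in the context, the following hold. For every x ≥ e^{h n₁} and every δ > 0, setting y = x^{1+δ}: (1+δ)ψ(y) − ψ(x) > 2δ/3 and |ψ(y) − ψ(x)| < 9δ. Moreover there is an absolute constant C > 0 such that if additionally δ ≤ 3/2, then (1+δ)ψ(y) − ψ(x) ≥ (2 − Cε²)δ. As consequences: (S.1) the map x ↦ x^{ψ(x)} is strictly increasing and continuous on [e^{h n₁}, ∞); (S.2) there is a constant C' > 0 such that (k+1)^{ψ(k+1)} − k^{ψ(k)} ≤ C' k^{ψ(k)−1} for all sufficiently large integers k. -/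
noncomputable section

/-- The data of the resonance windows: `0 < γ₀ < h`, a strictly increasing positive
sequence `nseq` tending to `∞`, and exponents `η s` with
`max{η_s n_s, |η_s − h| n_s} ≤ (ε²/50)·γ₀·n_{s+1}`. -/
def WindowData (h γ₀ ε : ℝ) (nseq η : ℕ → ℝ) : Prop :=
  0 < γ₀ ∧ γ₀ < h ∧ StrictMono nseq ∧ (∀ s, 0 < nseq s) ∧
  Filter.Tendsto nseq Filter.atTop Filter.atTop ∧
  (∀ s, 0 < η s) ∧
  (∀ s, max (η s * nseq s) (|η s - h| * nseq s) ≤ ε ^ 2 / 50 * (γ₀ * nseq (s + 1)))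

/-- `ψ` is the piecewise exponent function defined window-by-window: on the window
`[e^{h n_s}, e^{h n_{s+1}}]` it equals `2` if `η_s ≤ h`, while if `η_s > h` it equals
`4 − 2h n_s/ln x` on `[e^{h n_s}, e^{η_s n_s}]` and
`2 + ((2η_s n_s − 2h n_s)/ln x)·[1 − (ln x − η_s n_s)/(h n_{s+1} − η_s n_s)]` on
`[e^{η_s n_s}, e^{h n_{s+1}}]`; moreover it takes values in `[2, 4)`. -/
def IsResonanceExponent (h : ℝ) (nseq η : ℕ → ℝ) (ψ : ℝ → ℝ) : Prop :=
  (∀ x : ℝ, Real.exp (h * nseq 1) ≤ x → 2 ≤ ψ x ∧ ψ x < 4) ∧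
  ∀ s : ℕ, 1 ≤ s → ∀ x : ℝ,
    Real.exp (h * nseq s) ≤ x → x ≤ Real.exp (h * nseq (s + 1)) →
    (η s ≤ h → ψ x = 2) ∧
    (h < η s →
      (x ≤ Real.exp (η s * nseq s) → ψ x = 4 - 2 * h * nseq s / Real.log x) ∧
      (Real.exp (η s * nseq s) ≤ x →
        ψ x = 2 + ((2 * η s * nseq s - 2 * h * nseq s) / Real.log x) *
          (1 - (Real.log x - η s * nseq s) / (h * nseq (s + 1) - η s * nseq s))))

/-- A function that is monotone on all consecutive intervals of a monotone unbounded sequence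
is monotone on the half-line they cover. -/
theorem monotoneOn_Ici_of_forall_Icc {a : ℕ → ℝ} (ha : Monotone a)
    (hlim : Filter.Tendsto a Filter.atTop Filter.atTop) {f : ℝ → ℝ} {m : ℕ}
    (hf : ∀ s, m ≤ s → MonotoneOn f (Set.Icc (a s) (a (s + 1)))) :
    MonotoneOn f (Set.Ici (a m)) := by
  have key : ∀ s, m ≤ s → MonotoneOn f (Set.Icc (a m) (a s)) := by
    intro s hs
    induction s, hs using Nat.le_induction with
    | base => simp
    | succ s hs ih =>
      have := ih.union_right (hf s hs) (isGreatest_Icc (ha hs)) (isLeast_Icc (ha s.le_succ))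
      rwa [Set.Icc_union_Icc_eq_Icc (ha hs) (ha s.le_succ)] at this
  intro t ht u hu htu
  obtain ⟨s, hs, hus⟩ := ((Filter.eventually_ge_atTop m).and
    (hlim.eventually_ge_atTop u)).exists
  exact key s hs ⟨ht, htu.trans hus⟩ ⟨hu, hus⟩ htu

/-- In logarithmic coordinates, the exponent of `x ^ ψ x` has slope between `2 - ε ^ 2` and `4`. -/
theorem IsResonanceExponent.log_slope_bounds {h γ₀ ε : ℝ} {nseq η : ℕ → ℝ} {ψ : ℝ → ℝ}
    (hh : 0 < h) (hε : 0 < ε) (hε1 : ε < 1) (hW : WindowData h γ₀ ε nseq η)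
    (hψ : IsResonanceExponent h nseq η ψ) {t u : ℝ} (ht : h * nseq 1 ≤ t) (htu : t ≤ u) :
    (2 - ε ^ 2) * (u - t) ≤ u * ψ (Real.exp u) - t * ψ (Real.exp t) ∧
      u * ψ (Real.exp u) - t * ψ (Real.exp t) ≤ 4 * (u - t) := by
  obtain ⟨hγ, hγh, hmono, hpos, hlim, -, hmax⟩ := hW
  set G : ℝ → ℝ := fun t => t * ψ (Real.exp t) with hG
  have hε2 : ε ^ 2 < 1 := by nlinarith
  have window : ∀ s, 1 ≤ s →
      MonotoneOn (fun t => G t - (2 - ε ^ 2) * t) (Set.Icc (h * nseq s) (h * nseq (s + 1))) ∧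
      MonotoneOn (fun t => 4 * t - G t) (Set.Icc (h * nseq s) (h * nseq (s + 1))) := by
    intro s hs
    have hns := hpos s
    have hns' := hpos (s + 1)
    have hval := fun t (h1 : h * nseq s ≤ t) (h2 : t ≤ h * nseq (s + 1)) =>
      hψ.2 s hs (Real.exp t) (Real.exp_le_exp.2 h1) (Real.exp_le_exp.2 h2)
    simp only [Real.log_exp, Real.exp_le_exp] at hval
    have hε2pos : 0 < ε ^ 2 := by positivity
    rcases le_or_gt (η s) h with hη | hη
    · have hGe : ∀ t ∈ Set.Icc (h * nseq s) (h * nseq (s + 1)), G t = t * 2 := by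
        intro t ht
        simp only [hG, (hval t ht.1 ht.2).1 hη]
      constructor
      · intro t ht u hu htu
        simp only [hGe t ht, hGe u hu]
        nlinarith
      · intro t ht u hu htu
        simp only [hGe t ht, hGe u hu]
        linarith
    · have hb := hmax s
      rw [max_le_iff, abs_of_pos (sub_pos.2 hη)] at hb
      obtain ⟨hb1, hb2⟩ := hb
      have hγn : γ₀ * nseq (s + 1) ≤ h * nseq (s + 1) := by gcongr
      have hγn' : ε ^ 2 / 50 * (γ₀ * nseq (s + 1)) ≤ ε ^ 2 / 50 * (h * nseq (s + 1)) := by gcongr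
      have hN : 0 < h * nseq (s + 1) := by positivity
      have hD : 49 / 50 * (h * nseq (s + 1)) ≤ h * nseq (s + 1) - η s * nseq s := by nlinarith
      have hD0 : 0 < h * nseq (s + 1) - η s * nseq s := by nlinarith
      have hlow : h * nseq s ≤ η s * nseq s := by gcongr
      have hhigh : η s * nseq s ≤ h * nseq (s + 1) := by linarith
      set K := (2 * η s * nseq s - 2 * h * nseq s) / (h * nseq (s + 1) - η s * nseq s) with hK
      have hK0 : 0 ≤ K := div_nonneg (by linarith) hD0.le
      have hK1 : K ≤ ε ^ 2 := by
        rw [hK, div_le_iff₀ hD0]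
        nlinarith
      have hG1 : ∀ t ∈ Set.Icc (h * nseq s) (η s * nseq s), G t = 4 * t - 2 * h * nseq s := by
        intro t ht
        have ht0 : t ≠ 0 := ((mul_pos hh hns).trans_le ht.1).ne'
        simp only [hG, ((hval t ht.1 (ht.2.trans hhigh)).2 hη).1 ht.2]
        field_simp
      have hG2 : ∀ t ∈ Set.Icc (η s * nseq s) (h * nseq (s + 1)),
          G t = 2 * t + (2 * η s * nseq s - 2 * h * nseq s) - K * (t - η s * nseq s) := by
        intro t ht
        have ht0 : t ≠ 0 := ((mul_pos hh hns).trans_le (hlow.trans ht.1)).ne'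
        simp only [hG, ((hval t (hlow.trans ht.1) ht.2).2 hη).2 ht.1, hK]
        have := hD0.ne'
        field_simp
        ring
      rw [← Set.Icc_union_Icc_eq_Icc hlow hhigh]
      constructor
      · refine MonotoneOn.union_right ?_ ?_ (isGreatest_Icc hlow) (isLeast_Icc hhigh)
        · intro t ht u hu htu
          simp only [hG1 t ht, hG1 u hu]
          nlinarith
        · intro t ht u hu htu
          simp only [hG2 t ht, hG2 u hu]
          nlinarith
      · refine MonotoneOn.union_right ?_ ?_ (isGreatest_Icc hlow) (isLeast_Icc hhigh)
        · intro t ht u hu htu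
          simp only [hG1 t ht, hG1 u hu]
          linarith
        · intro t ht u hu htu
          simp only [hG2 t ht, hG2 u hu]
          nlinarith
  have hamono : Monotone fun s => h * nseq s := hmono.monotone.const_mul hh.le
  have halim := hlim.const_mul_atTop hh
  have h1 := monotoneOn_Ici_of_forall_Icc hamono halim (fun s hs => (window s hs).1) ht
    (ht.trans htu) htu
  have h2 := monotoneOn_Ici_of_forall_Icc hamono halim (fun s hs => (window s hs).2) ht
    (ht.trans htu) htu
  simp only [hG] at h1 h2
  constructor <;> linarith

/-- growth and oscillation estimates for the piecewise exponent `ψ`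
(Lemma `strictincrease`): there are absolute constants `c₀, C > 0` such that for all
window data with `0 < ε < c₀·min{1,h}` and all `x ≥ e^{h n₁}`, `δ > 0`, `y = x^{1+δ}`:
`(1+δ)ψ(y) − ψ(x) > 2δ/3`, `|ψ(y) − ψ(x)| < 9δ`, and if `δ ≤ 3/2` then
`(1+δ)ψ(y) − ψ(x) ≥ (2 − Cε²)δ`; consequently `x ↦ x^{ψ(x)}` is strictly increasing
and continuous on `[e^{h n₁}, ∞)`, and `(k+1)^{ψ(k+1)} − k^{ψ(k)} ≤ C' k^{ψ(k)−1}`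
for large integers `k`. -/
theorem psi_strict_increase :
    ∃ c₀ > (0 : ℝ), ∃ C > (0 : ℝ),
      ∀ (h γ₀ ε : ℝ) (nseq η : ℕ → ℝ) (ψ : ℝ → ℝ),
        0 < h → 0 < ε → ε < c₀ * min 1 h →
        WindowData h γ₀ ε nseq η →
        IsResonanceExponent h nseq η ψ →
        (∀ x : ℝ, Real.exp (h * nseq 1) ≤ x → ∀ δ : ℝ, 0 < δ →
          (2 * δ / 3 < (1 + δ) * ψ (x ^ (1 + δ)) - ψ x ∧
           |ψ (x ^ (1 + δ)) - ψ x| < 9 * δ) ∧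
          (δ ≤ 3 / 2 → (2 - C * ε ^ 2) * δ ≤ (1 + δ) * ψ (x ^ (1 + δ)) - ψ x)) ∧
        StrictMonoOn (fun x : ℝ => x ^ ψ x) (Set.Ici (Real.exp (h * nseq 1))) ∧
        ContinuousOn (fun x : ℝ => x ^ ψ x) (Set.Ici (Real.exp (h * nseq 1))) ∧
        ∃ C' > (0 : ℝ), ∃ k₀ : ℕ, ∀ k : ℕ, k₀ ≤ k →
          ((k : ℝ) + 1) ^ ψ ((k : ℝ) + 1) - (k : ℝ) ^ ψ (k : ℝ) ≤
            C' * (k : ℝ) ^ (ψ (k : ℝ) - 1) := by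
  refine ⟨1, one_pos, 1, one_pos, ?_⟩
  intro h γ₀ ε nseq η ψ hh hε hεc hW hψ
  have hε1 : ε < 1 := by linarith [min_le_left 1 h]
  have hε2 : ε ^ 2 < 1 := by nlinarith
  have hn1 : 0 < h * nseq 1 := mul_pos hh (hW.2.2.2.1 1)
  have hx0 : ∀ x, Real.exp (h * nseq 1) ≤ x → 0 < x := fun x hx => (Real.exp_pos _).trans_le hx
  have hlog : ∀ x, Real.exp (h * nseq 1) ≤ x → h * nseq 1 ≤ Real.log x := fun x hx =>
    (Real.le_log_iff_exp_le (hx0 x hx)).2 hx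
  have slope : ∀ x y, Real.exp (h * nseq 1) ≤ x → x ≤ y →
      (2 - ε ^ 2) * (Real.log y - Real.log x) ≤ Real.log y * ψ y - Real.log x * ψ x ∧
      Real.log y * ψ y - Real.log x * ψ x ≤ 4 * (Real.log y - Real.log x) := by
    intro x y hx hxy
    have := hψ.log_slope_bounds hh hε hε1 hW (hlog x hx)
      (Real.log_le_log (hx0 x hx) hxy)
    rwa [Real.exp_log (hx0 x hx), Real.exp_log (hx0 y (hx.trans hxy))] at this
  have hmono : StrictMonoOn (fun x : ℝ => Real.log x * ψ x)
      (Set.Ici (Real.exp (h * nseq 1))) := by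
    intro x hx y hy hxy
    have hl := Real.log_lt_log (hx0 x hx) hxy
    have := (slope x y hx hxy.le).1
    show Real.log x * ψ x < Real.log y * ψ y
    nlinarith
  have hrpow : Set.EqOn (fun x : ℝ => x ^ ψ x) (fun x => Real.exp (Real.log x * ψ x))
      (Set.Ici (Real.exp (h * nseq 1))) := fun x hx => Real.rpow_def_of_pos (hx0 x hx) _
  refine ⟨?_, ?_, ?_, ?_⟩
  · intro x hx δ hδ
    have ht : 0 < Real.log x := hn1.trans_le (hlog x hx)
    have hx1 : 1 ≤ x := (Real.one_le_exp hn1.le).trans hx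
    have hxy : x ≤ x ^ (1 + δ) := Real.self_le_rpow_of_one_le hx1 (by linarith)
    have hs := slope x _ hx hxy
    obtain ⟨hy2, hy4⟩ := hψ.1 _ (hx.trans hxy)
    rw [Real.log_rpow (hx0 x hx)] at hs
    set p := ψ (x ^ (1 + δ))
    have hlow : (2 - ε ^ 2) * δ ≤ (1 + δ) * p - ψ x := by
      refine le_of_mul_le_mul_left ?_ ht
      linarith [hs.1]
    have hup : (1 + δ) * p - ψ x ≤ 4 * δ := by
      refine le_of_mul_le_mul_left ?_ ht
      linarith [hs.2]
    refine ⟨⟨by nlinarith, ?_⟩, fun _ => by simpa using hlow⟩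
    rw [abs_lt]
    constructor <;> nlinarith
  · exact (Real.exp_strictMono.comp_strictMonoOn hmono).congr hrpow.symm
  · refine ContinuousOn.congr (Real.continuous_exp.comp_continuousOn ?_) hrpow
    have hlip : LipschitzOnWith 4 (fun t => t * ψ (Real.exp t)) (Set.Ici (h * nseq 1)) := by
      refine LipschitzOnWith.of_le_add_mul 4 ?_
      intro t ht u hu
      rw [Real.dist_eq]
      push_cast
      rcases le_total t u with htu | htu
      · have := (hψ.log_slope_bounds hh hε hε1 hW ht htu).1
        nlinarith [abs_nonneg (t - u)]
      · have := (hψ.log_slope_bounds hh hε hε1 hW hu htu).2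
        linarith [le_abs_self (t - u)]
    have hc := hlip.continuousOn.comp
      (Real.continuousOn_log.mono fun x hx => (hx0 x hx).ne') fun x hx => hlog x hx
    refine hc.congr fun x hx => ?_
    simp [Real.exp_log (hx0 x hx)]
  · obtain ⟨k₀, hk₀⟩ := exists_nat_ge (Real.exp (h * nseq 1))
    refine ⟨15, by norm_num, k₀, fun k hk => ?_⟩
    have hx : Real.exp (h * nseq 1) ≤ k := hk₀.trans (by exact_mod_cast hk)
    have hk0 := hx0 _ hx
    have hk1 : (1 : ℝ) ≤ k := (Real.one_le_exp hn1.le).trans hx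
    have hxy : (k : ℝ) ≤ k + 1 := by linarith
    have hs := (slope _ _ hx hxy).2
    have hpow : ((k : ℝ) + 1) ^ ψ ((k : ℝ) + 1) ≤
        (k : ℝ) ^ ψ (k : ℝ) * (((k : ℝ) + 1) / k) ^ 4 := by
      rw [Real.rpow_def_of_pos hk0, Real.rpow_def_of_pos (by linarith : (0 : ℝ) < k + 1),
        ← Real.exp_log (by positivity : (0 : ℝ) < (((k : ℝ) + 1) / k) ^ 4), ← Real.exp_add,
        Real.exp_le_exp, Real.log_pow, Real.log_div (by positivity) hk0.ne']
      push_cast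
      linarith
    have hfour : (((k : ℝ) + 1) / k) ^ 4 ≤ 1 + 15 / k := by
      have hr : 1 / (k : ℝ) ≤ 1 := by rw [div_le_one hk0]; exact hk1
      have hr0 : 0 < 1 / (k : ℝ) := by positivity
      rw [add_div, div_self hk0.ne', div_eq_mul_one_div (15 : ℝ)]
      generalize 1 / (k : ℝ) = r at hr hr0
      have h2 : r ^ 2 ≤ r := pow_le_of_le_one hr0.le hr (by norm_num)
      have h3 : r ^ 3 ≤ r := pow_le_of_le_one hr0.le hr (by norm_num)
      have h4 : r ^ 4 ≤ r := pow_le_of_le_one hr0.le hr (by norm_num)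
      linarith [show (1 + r) ^ 4 = 1 + 4 * r + 6 * r ^ 2 + 4 * r ^ 3 + r ^ 4 by ring]
    have hP : 0 ≤ (k : ℝ) ^ ψ (k : ℝ) := by positivity
    rw [Real.rpow_sub_one hk0.ne']
    calc ((k : ℝ) + 1) ^ ψ ((k : ℝ) + 1) - (k : ℝ) ^ ψ (k : ℝ)
        ≤ (k : ℝ) ^ ψ (k : ℝ) * (1 + 15 / k) - (k : ℝ) ^ ψ (k : ℝ) := by
          gcongr
          exact hpow.trans (by gcongr)
      _ = 15 * ((k : ℝ) ^ ψ (k : ℝ) / k) := by ring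
end
end

section
/- With the piecewise function ψ as defined in the context, the map ε̃ : x ↦ x^{−ψ(x)/2} is strictly decreasing and continuous on [e^{h n₁}, ∞), hence the equation ϵ = x^{−ψ(x)/2} defines a function x = x(ϵ) on (0, ε̃(e^{h n₁})]. Define f(ϵ) := 2/ψ(x(ϵ)) ∈ [1/2, 1]. Then f has the explicit form: for s with η_s ≤ h, f(ϵ) = 1 for ϵ^{−1} ∈ [e^{h n_s}, e^{h n_{s+1}}]; for s with η_s > h, f(ϵ) = 1/2 + h n_s/(2 ln ϵ^{−1}) for ϵ^{−1} ∈ [e^{h n_s}, e^{(2η_s − h)n_s}], and f(ϵ) = 1/(1−b_s) − (b_s/(1−b_s))·h n_{s+1}/ln ϵ^{−1} for ϵ^{−1} ∈ [e^{(2η_s − h)n_s}, e^{h n_{s+1}}], where b_s = (η_s − h)n_s/(h n_{s+1} − η_s n_s). Moreover, for every ϵ in the domain and every 0 ≤ τ < 1: f(ϵ^{1+τ}) − f(ϵ) ≤ (3/5)τ. -/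
noncomputable section

open Real Set

/-- Minus the logarithm of `x ^ (-ψ x / 2)`, as a function of `u = log x`. -/
def logExponent (ψ : ℝ → ℝ) (u : ℝ) : ℝ := u * ψ (exp u) / 2

theorem exp_rpow_neg_half_eq (ψ : ℝ → ℝ) (u : ℝ) :
    exp u ^ (-(ψ (exp u)) / 2) = exp (-logExponent ψ u) := by
  rw [← exp_mul, logExponent]
  congr 1
  ring

theorem rpow_neg_half_eq (ψ : ℝ → ℝ) {x : ℝ} (hx : 0 < x) :
    x ^ (-(ψ x) / 2) = exp (-logExponent ψ (log x)) := by
  rw [← exp_rpow_neg_half_eq, exp_log hx]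

/-- The slope correction `b_s` of the decaying part of a window. -/
def windowSlope (h : ℝ) (nseq η : ℕ → ℝ) (s : ℕ) : ℝ :=
  (η s - h) * nseq s / (h * nseq (s + 1) - η s * nseq s)

section Window

variable {h γ₀ ε : ℝ} {nseq η : ℕ → ℝ} {ψ : ℝ → ℝ}

theorem WindowData.le_div_fifty (W : WindowData h γ₀ ε nseq η) (hε : 0 < ε) (hε1 : ε < 1)
    (s : ℕ) :
    η s * nseq s ≤ h * nseq (s + 1) / 50 ∧ (η s - h) * nseq s ≤ h * nseq (s + 1) / 50 := by
  obtain ⟨hγ, hγh, -, hpos, -, -, hmax⟩ := W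
  have hp := hpos s
  have hp' := hpos (s + 1)
  have hm := hmax s
  rw [max_le_iff] at hm
  have h1 : ε ^ 2 / 50 * (γ₀ * nseq (s + 1)) ≤ 1 / 50 * (h * nseq (s + 1)) := by
    gcongr
    nlinarith
  have h2 : (η s - h) * nseq s ≤ |η s - h| * nseq s := by
    gcongr
    exact le_abs_self _
  constructor <;> linarith [hm.1, hm.2]

theorem WindowData.end_sub_pos (W : WindowData h γ₀ ε nseq η) (hε : 0 < ε) (hε1 : ε < 1)
    (s : ℕ) : 0 < h * nseq (s + 1) - η s * nseq s := by
  have h1 := (W.le_div_fifty hε hε1 s).1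
  have h2 : 0 < h * nseq (s + 1) := mul_pos (W.1.trans W.2.1) (W.2.2.2.1 _)
  linarith

theorem WindowData.windowSlope_le (W : WindowData h γ₀ ε nseq η) (hε : 0 < ε) (hε1 : ε < 1)
    (s : ℕ) : windowSlope h nseq η s ≤ 1 / 49 := by
  have h1 := W.le_div_fifty hε hε1 s
  rw [windowSlope, div_le_iff₀ (W.end_sub_pos hε hε1 s)]
  linarith [h1.1, h1.2]

theorem WindowData.windowSlope_pos (W : WindowData h γ₀ ε nseq η) (hε : 0 < ε) (hε1 : ε < 1)
    {s : ℕ} (hη : h < η s) : 0 < windowSlope h nseq η s :=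
  div_pos (mul_pos (sub_pos.2 hη) (W.2.2.2.1 s)) (W.end_sub_pos hε hε1 s)

theorem WindowData.windowSlope_mul (W : WindowData h γ₀ ε nseq η) (hε : 0 < ε) (hε1 : ε < 1)
    (s : ℕ) : windowSlope h nseq η s * (h * nseq (s + 1) - η s * nseq s) =
      (η s - h) * nseq s :=
  div_mul_cancel₀ _ (W.end_sub_pos hε hε1 s).ne'

theorem WindowData.start_pos (W : WindowData h γ₀ ε nseq η) (s : ℕ) : 0 < h * nseq s :=
  mul_pos (W.1.trans W.2.1) (W.2.2.2.1 _)

theorem WindowData.start_mono (W : WindowData h γ₀ ε nseq η) : Monotone fun s => h * nseq s :=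
  fun _ _ hst => mul_le_mul_of_nonneg_left (W.2.2.1.monotone hst) (W.1.trans W.2.1).le

theorem IsResonanceExponent.logExponent_eq (W : WindowData h γ₀ ε nseq η)
    (hε : 0 < ε) (hε1 : ε < 1) (R : IsResonanceExponent h nseq η ψ) {s : ℕ} (hs : 1 ≤ s)
    {u : ℝ} (hu : h * nseq s ≤ u) (hu' : u ≤ h * nseq (s + 1)) :
    (η s ≤ h → logExponent ψ u = u) ∧
    (h < η s →
      (u ≤ η s * nseq s → logExponent ψ u = 2 * u - h * nseq s) ∧
      (η s * nseq s ≤ u →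
        logExponent ψ u = u + windowSlope h nseq η s * (h * nseq (s + 1) - u))) := by
  have hd := W.end_sub_pos hε hε1 s
  have hu0 : 0 < u := (W.start_pos s).trans_le hu
  obtain ⟨h1, h2⟩ := R.2 s hs (exp u) (exp_le_exp.2 hu) (exp_le_exp.2 hu')
  simp only [exp_le_exp, log_exp] at h2
  refine ⟨fun hη => ?_, fun hη => ⟨fun hle => ?_, fun hle => ?_⟩⟩
  · rw [logExponent, h1 hη]
    ring
  · rw [logExponent, (h2 hη).1 hle]
    field_simp
    ring
  · rw [logExponent, (h2 hη).2 hle, windowSlope]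
    field_simp
    ring

theorem IsResonanceExponent.logExponent_start (W : WindowData h γ₀ ε nseq η)
    (hε : 0 < ε) (hε1 : ε < 1) (R : IsResonanceExponent h nseq η ψ) {s : ℕ} (hs : 1 ≤ s) :
    logExponent ψ (h * nseq s) = h * nseq s := by
  have H := R.logExponent_eq W hε hε1 hs le_rfl (W.start_mono s.le_succ)
  rcases le_or_gt (η s) h with hη | hη
  · exact H.1 hη
  · rw [(H.2 hη).1 (mul_le_mul_of_nonneg_right hη.le (W.2.2.2.1 s).le)]
    ring

/-- On a single window, `logExponent` has slope between `48 / 49` and `2`. -/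
theorem IsResonanceExponent.logExponent_sub_window (W : WindowData h γ₀ ε nseq η)
    (hε : 0 < ε) (hε1 : ε < 1) (R : IsResonanceExponent h nseq η ψ) {s : ℕ} (hs : 1 ≤ s)
    {u v : ℝ} (hu : h * nseq s ≤ u) (huv : u ≤ v) (hv : v ≤ h * nseq (s + 1)) :
    48 / 49 * (v - u) ≤ logExponent ψ v - logExponent ψ u ∧
      logExponent ψ v - logExponent ψ u ≤ 2 * (v - u) := by
  have Hu := R.logExponent_eq W hε hε1 hs hu (huv.trans hv)
  have Hv := R.logExponent_eq W hε hε1 hs (hu.trans huv) hv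
  rcases le_or_gt (η s) h with hη | hη
  · rw [Hu.1 hη, Hv.1 hη]
    constructor <;> linarith
  have hb := W.windowSlope_le hε hε1 s
  have hb0 := W.windowSlope_pos hε hε1 hη
  have hm := W.windowSlope_mul hε hε1 s
  rcases le_total v (η s * nseq s) with hve | hve
  · rw [(Hu.2 hη).1 (huv.trans hve), (Hv.2 hη).1 hve]
    constructor <;> linarith
  rcases le_total u (η s * nseq s) with hue | hue
  · rw [(Hu.2 hη).1 hue, (Hv.2 hη).2 hve]
    constructor <;> nlinarith [mul_nonneg hb0.le (sub_nonneg.2 hve),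
      mul_le_mul_of_nonneg_right hb (sub_nonneg.2 hve)]
  · rw [(Hu.2 hη).2 hue, (Hv.2 hη).2 hve]
    constructor <;> nlinarith [mul_nonneg hb0.le (sub_nonneg.2 huv),
      mul_le_mul_of_nonneg_right hb (sub_nonneg.2 huv)]

/-- Globally, `logExponent` has slope between `48 / 49` and `2`. -/
theorem IsResonanceExponent.logExponent_sub (W : WindowData h γ₀ ε nseq η)
    (hε : 0 < ε) (hε1 : ε < 1) (R : IsResonanceExponent h nseq η ψ)
    {u v : ℝ} (hu : h * nseq 1 ≤ u) (huv : u ≤ v) :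
    48 / 49 * (v - u) ≤ logExponent ψ v - logExponent ψ u ∧
      logExponent ψ v - logExponent ψ u ≤ 2 * (v - u) := by
  have key : ∀ k : ℕ, 1 ≤ k → ∀ u v : ℝ, h * nseq 1 ≤ u → u ≤ v → v ≤ h * nseq k →
      48 / 49 * (v - u) ≤ logExponent ψ v - logExponent ψ u ∧
        logExponent ψ v - logExponent ψ u ≤ 2 * (v - u) := by
    intro k hk
    induction k, hk using Nat.le_induction with
    | base =>
      intro u v hu huv hv
      obtain rfl : u = v := by linarith
      simp
    | succ k hk ih =>
      intro u v hu huv hv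
      rcases le_total v (h * nseq k) with hvk | hvk
      · exact ih u v hu huv hvk
      rcases le_total u (h * nseq k) with huk | huk
      · have h1 := ih u _ hu huk le_rfl
        have h2 := R.logExponent_sub_window W hε hε1 hk le_rfl hvk hv
        constructor <;> linarith [h1.1, h1.2, h2.1, h2.2]
      · exact R.logExponent_sub_window W hε hε1 hk huk huv hv
  obtain ⟨k, hk, hvk⟩ := ((Filter.eventually_ge_atTop 1).and
    ((W.2.2.2.2.1.const_mul_atTop (W.1.trans W.2.1)).eventually_ge_atTop v)).exists
  exact key k hk u v hu huv hvk

theorem IsResonanceExponent.strictMonoOn_logExponent (W : WindowData h γ₀ ε nseq η)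
    (hε : 0 < ε) (hε1 : ε < 1) (R : IsResonanceExponent h nseq η ψ) :
    StrictMonoOn (logExponent ψ) (Ici (h * nseq 1)) := fun u hu v _ huv => by
  linarith [(R.logExponent_sub W hε hε1 hu huv.le).1]

theorem IsResonanceExponent.continuousOn_logExponent (W : WindowData h γ₀ ε nseq η)
    (hε : 0 < ε) (hε1 : ε < 1) (R : IsResonanceExponent h nseq η ψ) :
    ContinuousOn (logExponent ψ) (Ici (h * nseq 1)) := by
  have hL : LipschitzOnWith 2 (logExponent ψ) (Ici (h * nseq 1)) := by
    refine LipschitzOnWith.of_le_add_mul _ fun u hu v hv => ?_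
    rw [Real.dist_eq]
    push_cast
    rcases le_total u v with huv | huv
    · linarith [(R.logExponent_sub W hε hε1 hu huv).1, abs_nonneg (u - v)]
    · linarith [(R.logExponent_sub W hε hε1 hv huv).2, le_abs_self (u - v)]
  exact hL.continuousOn

theorem IsResonanceExponent.exists_logExponent_eq (W : WindowData h γ₀ ε nseq η)
    (hε : 0 < ε) (hε1 : ε < 1) (R : IsResonanceExponent h nseq η ψ) {w : ℝ}
    (hw : logExponent ψ (h * nseq 1) ≤ w) :
    ∃ u, h * nseq 1 ≤ u ∧ logExponent ψ u = w := by
  set a := h * nseq 1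
  set v := a + 2 * (w - logExponent ψ a)
  have hv : a ≤ v := by linarith
  have h1 := (R.logExponent_sub W hε hε1 le_rfl hv).1
  obtain ⟨u, hu, rfl⟩ := intermediate_value_Icc hv
    ((R.continuousOn_logExponent W hε hε1).mono Icc_subset_Ici_self)
    ⟨hw, show w ≤ logExponent ψ v by linarith⟩
  exact ⟨u, hu.1, rfl⟩

/-- The inequality `f (ϵ ^ (1 + τ)) - f ϵ ≤ 3 / 5 * τ` in logarithmic coordinates. -/
theorem IsResonanceExponent.div_logExponent_sub_le (W : WindowData h γ₀ ε nseq η)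
    (hε : 0 < ε) (hε1 : ε < 1) (R : IsResonanceExponent h nseq η ψ) {u v τ : ℝ}
    (hu : h * nseq 1 ≤ u) (huv : u ≤ v) (hτ : 0 ≤ τ) (hle : logExponent ψ u ≤ 2 * u)
    (hpos : 0 < logExponent ψ u) (hv : logExponent ψ v = (1 + τ) * logExponent ψ u) :
    v / logExponent ψ v - u / logExponent ψ u ≤ 3 / 5 * τ := by
  have h1 := (R.logExponent_sub W hε hε1 hu huv).1
  rw [hv] at h1 ⊢
  generalize logExponent ψ u = y at *
  have h2 : v - (1 + τ) * u ≤ 3 / 5 * τ * y := by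
    nlinarith [mul_le_mul_of_nonneg_left hle hτ, mul_nonneg hτ hpos.le]
  have h3 : v / ((1 + τ) * y) - u / y = (v - (1 + τ) * u) / ((1 + τ) * y) := by
    field_simp
  rw [h3, div_le_iff₀ (by positivity)]
  nlinarith [mul_nonneg (mul_nonneg hτ hpos.le) hτ]

end Window

/-- the map `ε̃ : x ↦ x^{−ψ(x)/2}` is strictly decreasing and continuous,
so it has a well-defined inverse `x(ϵ)`, and the function `f(ϵ) := 2/ψ(x(ϵ)) ∈ [1/2, 1]`
has the explicit window form; moreover `f(ϵ^{1+τ}) − f(ϵ) ≤ (3/5)τ` for `0 ≤ τ < 1`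
(Lemma `in1`). -/
theorem f_explicit_form :
    ∃ c₀ > (0 : ℝ), ∀ (h γ₀ ε : ℝ) (nseq η : ℕ → ℝ) (ψ : ℝ → ℝ),
      0 < h → 0 < ε → ε < c₀ * min 1 h →
      WindowData h γ₀ ε nseq η →
      IsResonanceExponent h nseq η ψ →
      -- `ε̃` is strictly decreasing and continuous on `[e^{h n₁}, ∞)` …
      StrictAntiOn (fun x : ℝ => x ^ (-(ψ x) / 2)) (Set.Ici (Real.exp (h * nseq 1))) ∧
      ContinuousOn (fun x : ℝ => x ^ (-(ψ x) / 2)) (Set.Ici (Real.exp (h * nseq 1))) ∧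
      -- … hence `ϵ = x^{−ψ(x)/2}` defines a function `x = x(ϵ)` on the range of `ε̃`:
      (∀ ϵ : ℝ, 0 < ϵ →
        ϵ ≤ Real.exp (h * nseq 1) ^ (-(ψ (Real.exp (h * nseq 1))) / 2) →
        ∃! x : ℝ, x ∈ Set.Ici (Real.exp (h * nseq 1)) ∧ x ^ (-(ψ x) / 2) = ϵ) ∧
      -- any `f` with `f(ε̃ x) = 2/ψ(x)` takes values in `[1/2, 1]`, has the explicit
      -- window form, and satisfies the dislocation inequality:
      ∀ f : ℝ → ℝ,
        (∀ x : ℝ, Real.exp (h * nseq 1) ≤ x → f (x ^ (-(ψ x) / 2)) = 2 / ψ x) →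
        (∀ x : ℝ, Real.exp (h * nseq 1) ≤ x →
          f (x ^ (-(ψ x) / 2)) ∈ Set.Icc (1/2 : ℝ) 1) ∧
        (∀ ϵ : ℝ, 0 < ϵ →
          ϵ ≤ Real.exp (h * nseq 1) ^ (-(ψ (Real.exp (h * nseq 1))) / 2) →
          ∀ s : ℕ, 1 ≤ s →
          (η s ≤ h → Real.exp (h * nseq s) ≤ ϵ⁻¹ → ϵ⁻¹ ≤ Real.exp (h * nseq (s + 1)) →
            f ϵ = 1) ∧
          (h < η s →
            (Real.exp (h * nseq s) ≤ ϵ⁻¹ →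
              ϵ⁻¹ ≤ Real.exp ((2 * η s - h) * nseq s) →
              f ϵ = 1 / 2 + h * nseq s / (2 * Real.log ϵ⁻¹)) ∧
            (Real.exp ((2 * η s - h) * nseq s) ≤ ϵ⁻¹ →
              ϵ⁻¹ ≤ Real.exp (h * nseq (s + 1)) →
              f ϵ = 1 / (1 - (η s - h) * nseq s / (h * nseq (s + 1) - η s * nseq s)) -
                ((η s - h) * nseq s / (h * nseq (s + 1) - η s * nseq s)) /
                  (1 - (η s - h) * nseq s / (h * nseq (s + 1) - η s * nseq s)) *
                  (h * nseq (s + 1)) / Real.log ϵ⁻¹))) ∧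
        (∀ ϵ : ℝ, 0 < ϵ →
          ϵ ≤ Real.exp (h * nseq 1) ^ (-(ψ (Real.exp (h * nseq 1))) / 2) →
          ∀ τ : ℝ, 0 ≤ τ → τ < 1 →
            f (ϵ ^ (1 + τ)) - f ϵ ≤ 3 / 5 * τ) := by
  refine ⟨1, one_pos, fun h γ₀ ε nseq η ψ hh hε hεc W R => ?_⟩
  have hε1 : ε < 1 := by linarith [min_le_left 1 h]
  have ha : 0 < h * nseq 1 := W.start_pos 1
  have hmono := R.strictMonoOn_logExponent W hε hε1
  have hpos : ∀ x : ℝ, exp (h * nseq 1) ≤ x → 0 < x := fun x hx => (exp_pos _).trans_le hx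
  have hlog : ∀ x : ℝ, exp (h * nseq 1) ≤ x → h * nseq 1 ≤ log x := fun x hx =>
    (le_log_iff_exp_le (hpos x hx)).2 hx
  have hanti : StrictAntiOn (fun x : ℝ => x ^ (-(ψ x) / 2)) (Ici (exp (h * nseq 1))) := by
    intro x hx y hy hxy
    simp only [rpow_neg_half_eq ψ (hpos x hx), rpow_neg_half_eq ψ (hpos y hy), exp_lt_exp,
      neg_lt_neg_iff]
    exact hmono (hlog x hx) (hlog y hy) (log_lt_log (hpos x hx) hxy)
  have hex : ∀ ϵ : ℝ, 0 < ϵ →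
      ϵ ≤ exp (h * nseq 1) ^ (-(ψ (exp (h * nseq 1))) / 2) →
      ∃ u, h * nseq 1 ≤ u ∧ exp (-logExponent ψ u) = ϵ := by
    intro ϵ hϵ hle
    rw [exp_rpow_neg_half_eq, ← log_le_iff_le_exp hϵ] at hle
    obtain ⟨u, hu, hu'⟩ := R.exists_logExponent_eq W hε hε1 (w := -log ϵ) (by linarith)
    exact ⟨u, hu, by rw [hu', neg_neg, exp_log hϵ]⟩
  refine ⟨hanti, ?_, ?_, ?_⟩
  · have hc : ContinuousOn (fun x : ℝ => exp (-logExponent ψ (log x)))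
        (Ici (exp (h * nseq 1))) :=
      (((R.continuousOn_logExponent W hε hε1).comp
        (continuousOn_log.mono fun x hx => (hpos x hx).ne') fun x hx => hlog x hx).neg).rexp
    exact hc.congr fun x hx => rpow_neg_half_eq ψ (hpos x hx)
  · intro ϵ hϵ hle
    obtain ⟨u, hu, hu'⟩ := hex ϵ hϵ hle
    have hmem : exp u ∈ Ici (exp (h * nseq 1)) := exp_le_exp.2 hu
    have heq : exp u ^ (-(ψ (exp u)) / 2) = ϵ := by rw [exp_rpow_neg_half_eq, hu']
    exact ⟨exp u, ⟨hmem, heq⟩, fun y hy => hanti.injOn hy.1 hmem (hy.2.trans heq.symm)⟩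
  · intro f hf
    have hψ : ∀ u, h * nseq 1 ≤ u → 2 ≤ ψ (exp u) ∧ ψ (exp u) < 4 := fun u hu =>
      R.1 _ (exp_le_exp.2 hu)
    have hfu : ∀ u, h * nseq 1 ≤ u → f (exp (-logExponent ψ u)) = u / logExponent ψ u := by
      intro u hu
      rw [← exp_rpow_neg_half_eq, hf _ (exp_le_exp.2 hu), logExponent]
      have h1 := (hψ u hu).1
      have h2 := ha.trans_le hu
      field_simp
    refine ⟨fun x hx => ?_, fun ϵ hϵ hle s hs => ?_, fun ϵ hϵ hle τ hτ _ => ?_⟩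
    · obtain ⟨h1, h2⟩ := R.1 x hx
      rw [hf x hx]
      constructor
      · rw [div_le_div_iff₀ (by norm_num) (by linarith)]
        linarith
      · rw [div_le_one (by linarith)]
        exact h1
    · obtain ⟨u, hu, rfl⟩ := hex ϵ hϵ hle
      have hs1 : h * nseq 1 ≤ h * nseq s := W.start_mono hs
      have hs2 : h * nseq s ≤ h * nseq (s + 1) := W.start_mono s.le_succ
      have hd := W.end_sub_pos hε hε1 s
      have hu0 : 0 < u := ha.trans_le hu
      have hg0 : 0 < logExponent ψ u := by
        have := (hψ u hu).1
        unfold logExponent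
        positivity
      have hstart : h * nseq s ≤ logExponent ψ u → h * nseq s ≤ u := fun H =>
        (hmono.le_iff_le hs1 hu).1 ((R.logExponent_start W hε hε1 hs).trans_le H)
      have hend : logExponent ψ u ≤ h * nseq (s + 1) → u ≤ h * nseq (s + 1) := fun H =>
        (hmono.le_iff_le hu (hs1.trans hs2)).1
          (H.trans_eq (R.logExponent_start W hε hε1 (by omega)).symm)
      rw [← exp_neg, neg_neg, log_exp, hfu u hu]
      simp only [exp_le_exp]
      refine ⟨fun hη h1 h2 => ?_, fun hη => ?_⟩
      · rw [(R.logExponent_eq W hε hε1 hs (hstart h1) (hend h2)).1 hη, div_self hu0.ne']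
      have hse : h * nseq s ≤ η s * nseq s :=
        mul_le_mul_of_nonneg_right hη.le (W.2.2.2.1 s).le
      have hmid : logExponent ψ (η s * nseq s) = (2 * η s - h) * nseq s := by
        rw [((R.logExponent_eq W hε hε1 hs hse (by linarith)).2 hη).1 le_rfl]
        ring
      refine ⟨fun h1 h2 => ?_, fun h1 h2 => ?_⟩
      · have hue : u ≤ η s * nseq s :=
          (hmono.le_iff_le hu (hs1.trans hse)).1 (h2.trans_eq hmid.symm)
        have hg := ((R.logExponent_eq W hε hε1 hs (hstart h1) (by linarith)).2 hη).1 hue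
        have hu2 : u = (logExponent ψ u + h * nseq s) / 2 := by linarith
        generalize logExponent ψ u = y at *
        rw [hu2]
        field_simp
      · have hue : η s * nseq s ≤ u :=
          (hmono.le_iff_le (hs1.trans hse) hu).1 (hmid.trans_le h1)
        have hg := ((R.logExponent_eq W hε hε1 hs (hse.trans hue) (hend h2)).2 hη).2 hue
        have hb := W.windowSlope_le hε hε1 s
        rw [← windowSlope]
        generalize windowSlope h nseq η s = b at *
        have hb1 : 0 < 1 - b := by linarith
        have hu2 : u = (logExponent ψ u - b * (h * nseq (s + 1))) / (1 - b) := by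
          rw [eq_div_iff hb1.ne']
          linarith
        generalize logExponent ψ u = y at *
        rw [hu2]
        field_simp
    · obtain ⟨u, hu, rfl⟩ := hex ϵ hϵ hle
      have hu0 : 0 < u := ha.trans_le hu
      have hψu := hψ u hu
      have hg0 : 0 < logExponent ψ u := by
        have := hψu.1
        unfold logExponent
        positivity
      have hg2 : logExponent ψ u ≤ 2 * u := by
        unfold logExponent
        nlinarith
      have hge : logExponent ψ u ≤ (1 + τ) * logExponent ψ u := by nlinarith
      obtain ⟨v, hv, hv'⟩ := R.exists_logExponent_eq W hε hε1
        (((hmono.le_iff_le self_mem_Ici hu).2 hu).trans hge)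
      have huv : u ≤ v := (hmono.le_iff_le hu hv).1 (hge.trans_eq hv'.symm)
      have hpow : exp (-logExponent ψ u) ^ (1 + τ) = exp (-logExponent ψ v) := by
        rw [← exp_mul, hv']
        congr 1
        ring
      rw [hpow, hfu u hu, hfu v hv]
      exact R.div_logExponent_sub_le W hε hε1 hu huv hτ hg2 hg0 hv'
end
end

section
/- Let µ be a finite positive Borel measure on ℝ, E ∈ ℝ, and define Im M(E + iϵ') := ∫ ϵ'/((E'−E)² + ϵ'²) dµ(E') for ϵ' > 0. With the piecewise function ψ and the derived function f as in the context, let C̃ ≥ 1 and suppose there is ε₀ > 0 in the domain of f such that µ((E−ϵ', E+ϵ')) ≤ ϵ'^{f(ϵ') − C̃ε} for all 0 < ϵ' ≤ ε₀. Then there exist ε* > 0 (depending only on ε₀, ε, C̃, and the data defining ψ) and a constant C > 0 such that for every 0 < ϵ ≤ ε* and every τ ≥ 0: µ((E−ϵ, E+ϵ)) ≥ ϵ^{1+τ}·Im M(E + iϵ^{1+τ}) − C·ϵ^{f(ϵ) + 2τ − 3C̃ε}. -/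
open MeasureTheory

noncomputable section

/-- `ϵ'·Im M(E + iϵ') = ∫ ϵ'²/((E'−E)² + ϵ'²) dµ(E')`, where `M` is the Borel
transform of `µ`; here we record `Im M(E + iϵ') = ∫ ϵ'/((E'−E)² + ϵ'²) dµ(E')`. -/
def ImM (μ : Measure ℝ) (E ϵ' : ℝ) : ℝ :=
  ∫ x, ϵ' / ((x - E) ^ 2 + ϵ' ^ 2) ∂μ

section Windows

/-- Monotonicity on consecutive windows `[t s, t (s + 1)]`, `s ≥ 1`, exhausting `[t 1, ∞)`. -/
theorem monotoneOn_Ici_of_windows {g : ℝ → ℝ} {t : ℕ → ℝ} (ht : Monotone t)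
    (htop : Filter.Tendsto t Filter.atTop Filter.atTop)
    (hg : ∀ s, 1 ≤ s → MonotoneOn g (Set.Icc (t s) (t (s + 1)))) :
    MonotoneOn g (Set.Ici (t 1)) := by
  have hIcc : ∀ s, 1 ≤ s → MonotoneOn g (Set.Icc (t 1) (t s)) := by
    intro s hs
    induction s, hs using Nat.le_induction with
    | base => simp
    | succ s hs ih =>
      have h1 := ht hs
      have h2 := ht s.le_succ
      have := ih.union_right (hg s hs) (isGreatest_Icc h1) (isLeast_Icc h2)
      rwa [Set.Icc_union_Icc_eq_Icc h1 h2] at this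
  intro a ha b hb hab
  obtain ⟨s, hs1, hs⟩ := ((Filter.eventually_ge_atTop 1).and (htop.eventually_ge_atTop b)).exists
  exact hIcc s hs1 ⟨ha, hab.trans hs⟩ ⟨hb, hs⟩ hab

theorem monotoneOn_of_eq_affine {g : ℝ → ℝ} {S : Set ℝ} {m c : ℝ} (hm : 0 ≤ m)
    (hg : ∀ x ∈ S, g x = m * x + c) : MonotoneOn g S := by
  intro a ha b hb hab
  rw [hg a ha, hg b hb]
  gcongr

/-- `logScale ψ L = -log ϵ` for `ϵ = x ^ (-ψ x / 2)` and `x = exp L`. -/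
def logScale (ψ : ℝ → ℝ) (L : ℝ) : ℝ := ψ (Real.exp L) * L / 2

theorem exp_rpow_neg_half (ψ : ℝ → ℝ) (L : ℝ) :
    Real.exp L ^ (-(ψ (Real.exp L)) / 2) = Real.exp (-logScale ψ L) := by
  rw [← Real.exp_mul, logScale]
  ring_nf

variable {h γ₀ ε : ℝ} {nseq η : ℕ → ℝ} {ψ : ℝ → ℝ}

theorem WindowData.four_mul_le (hε : 0 < ε) (hε1 : ε < 1) (hW : WindowData h γ₀ ε nseq η)
    (s : ℕ) : 4 * (η s * nseq s) ≤ h * nseq (s + 1) := by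
  obtain ⟨hγ, hγh, -, hn, -, -, hmax⟩ := hW
  have h1 := (le_max_left _ _).trans (hmax s)
  have h2 : γ₀ * nseq (s + 1) ≤ h * nseq (s + 1) := by
    have := (hn (s + 1)).le
    gcongr
  have h3 : 0 < γ₀ * nseq (s + 1) := mul_pos hγ (hn _)
  have h4 : ε ^ 2 ≤ 1 := by nlinarith
  nlinarith

/-- On each window the logarithmic scale is piecewise affine with slopes in `[2/3, 2]`. -/
theorem logScale_window (hh : 0 < h) (hε : 0 < ε) (hε1 : ε < 1)
    (hW : WindowData h γ₀ ε nseq η) (hψ : IsResonanceExponent h nseq η ψ) {s : ℕ} (hs : 1 ≤ s) :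
    MonotoneOn (fun L => logScale ψ L - 2 / 3 * L)
        (Set.Icc (h * nseq s) (h * nseq (s + 1))) ∧
      MonotoneOn (fun L => 2 * L - logScale ψ L)
        (Set.Icc (h * nseq s) (h * nseq (s + 1))) := by
  have h4 := hW.four_mul_le hε hε1 s
  obtain ⟨-, -, -, hn, -, hη, -⟩ := hW
  have hpos : 0 < h * nseq s := mul_pos hh (hn s)
  have hηpos : 0 < η s * nseq s := mul_pos (hη s) (hn s)
  have key : ∀ L ∈ Set.Icc (h * nseq s) (h * nseq (s + 1)), _ := fun L hL =>
    hψ.2 s hs (Real.exp L) (Real.exp_le_exp.2 hL.1) (Real.exp_le_exp.2 hL.2)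
  simp only [Real.log_exp, Real.exp_le_exp] at key
  rcases le_or_gt (η s) h with hle | hlt
  · have hG : ∀ L ∈ Set.Icc (h * nseq s) (h * nseq (s + 1)), logScale ψ L = L := fun L hL => by
      rw [logScale, (key L hL).1 hle]
      ring
    constructor
    · exact monotoneOn_of_eq_affine (m := 1 / 3) (c := 0) (by norm_num)
        fun L hL => by rw [hG L hL]; ring
    · exact monotoneOn_of_eq_affine (m := 1) (c := 0) (by norm_num)
        fun L hL => by rw [hG L hL]; ring
  · have hmid : h * nseq s ≤ η s * nseq s := mul_le_mul_of_nonneg_right hlt.le (hn s).le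
    have hmid' : η s * nseq s ≤ h * nseq (s + 1) := by linarith
    have hG₁ : ∀ L ∈ Set.Icc (h * nseq s) (η s * nseq s),
        logScale ψ L = 2 * L - h * nseq s := fun L hL => by
      have hL0 : L ≠ 0 := (hpos.trans_le hL.1).ne'
      rw [logScale, ((key L ⟨hL.1, hL.2.trans hmid'⟩).2 hlt).1 hL.2]
      field_simp
      ring
    set D := h * nseq (s + 1) - η s * nseq s with hD
    have hDpos : 0 < D := by linarith
    set κ := (η s * nseq s - h * nseq s) / D with hκ
    have hκ0 : 0 ≤ κ := div_nonneg (by linarith) hDpos.le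
    have hκ1 : κ ≤ 1 / 3 := by
      rw [hκ, div_le_iff₀ hDpos]
      linarith
    have hG₂ : ∀ L ∈ Set.Icc (η s * nseq s) (h * nseq (s + 1)),
        logScale ψ L = (1 - κ) * L + (η s * nseq s - h * nseq s + κ * (η s * nseq s)) :=
      fun L hL => by
        have hL0 : L ≠ 0 := (hηpos.trans_le hL.1).ne'
        rw [logScale, ((key L ⟨hmid.trans hL.1, hL.2⟩).2 hlt).2 hL.1, hκ]
        field_simp
        ring
    rw [← Set.Icc_union_Icc_eq_Icc hmid hmid']
    constructor
    · refine MonotoneOn.union_right (c := η s * nseq s) ?_ ?_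
        (isGreatest_Icc hmid) (isLeast_Icc hmid')
      · exact monotoneOn_of_eq_affine (m := 4 / 3) (c := -(h * nseq s)) (by norm_num)
          fun L hL => by rw [hG₁ L hL]; ring
      · exact monotoneOn_of_eq_affine (m := 1 / 3 - κ)
          (c := η s * nseq s - h * nseq s + κ * (η s * nseq s)) (by linarith)
          fun L hL => by rw [hG₂ L hL]; ring
    · refine MonotoneOn.union_right (c := η s * nseq s) ?_ ?_
        (isGreatest_Icc hmid) (isLeast_Icc hmid')
      · exact monotoneOn_of_eq_affine (m := 0) (c := h * nseq s) le_rfl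
          fun L hL => by rw [hG₁ L hL]; ring
      · exact monotoneOn_of_eq_affine (m := 1 + κ)
          (c := -(η s * nseq s - h * nseq s + κ * (η s * nseq s))) (by linarith)
          fun L hL => by rw [hG₂ L hL]; ring

theorem logScale_Ici (hh : 0 < h) (hε : 0 < ε) (hε1 : ε < 1)
    (hW : WindowData h γ₀ ε nseq η) (hψ : IsResonanceExponent h nseq η ψ) :
    MonotoneOn (fun L => logScale ψ L - 2 / 3 * L) (Set.Ici (h * nseq 1)) ∧
      MonotoneOn (fun L => 2 * L - logScale ψ L) (Set.Ici (h * nseq 1)) := by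
  have hmono : Monotone fun s => h * nseq s := hW.2.2.1.monotone.const_mul hh.le
  have htop : Filter.Tendsto (fun s => h * nseq s) Filter.atTop Filter.atTop :=
    hW.2.2.2.2.1.const_mul_atTop hh
  exact ⟨monotoneOn_Ici_of_windows hmono htop
      fun s hs => (logScale_window hh hε hε1 hW hψ hs).1,
    monotoneOn_Ici_of_windows hmono htop
      fun s hs => (logScale_window hh hε hε1 hW hψ hs).2⟩

/-- A function with increments between `2/3` and `2` times those of its argument attains every
value above its initial one. -/
theorem exists_eq_of_slope_bounds {g : ℝ → ℝ} {a y : ℝ}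
    (hlow : MonotoneOn (fun L => g L - 2 / 3 * L) (Set.Ici a))
    (hup : MonotoneOn (fun L => 2 * L - g L) (Set.Ici a)) (hy : g a ≤ y) :
    ∃ L, a ≤ L ∧ g L = y := by
  have hlip : LipschitzOnWith 2 g (Set.Ici a) := by
    refine LipschitzOnWith.of_le_add_mul _ fun u hu v hv => ?_
    rw [Real.dist_eq]
    push_cast
    rcases le_total u v with huv | huv
    · have := hlow hu hv huv
      simp only at this
      have := abs_nonneg (u - v)
      linarith
    · have := hup hv hu huv
      simp only at this
      have := le_abs_self (u - v)
      linarith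
  set b := a + 3 / 2 * (y - g a) with hb
  have hab : a ≤ b := by linarith
  have hgb : y ≤ g b := by
    have := hlow Set.self_mem_Ici hab hab
    simp only at this
    linarith
  obtain ⟨L, hL, hLy⟩ := intermediate_value_Icc hab
    (hlip.continuousOn.mono Set.Icc_subset_Ici_self) ⟨hy, hgb⟩
  exact ⟨L, hL.1, hLy⟩

end Windows

section Poisson

theorem sq_div_add_sq_le_one (y δ : ℝ) : δ ^ 2 / (y ^ 2 + δ ^ 2) ≤ 1 :=
  div_le_one_of_le₀ (by nlinarith [sq_nonneg y]) (by positivity)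

theorem sq_div_add_sq_le {y δ r : ℝ} (hr : 0 < r) (hy : r ≤ |y|) :
    δ ^ 2 / (y ^ 2 + δ ^ 2) ≤ (δ / r) ^ 2 := by
  have h1 : r ^ 2 ≤ y ^ 2 := by
    rw [← sq_abs y]
    gcongr
  rw [div_pow]
  gcongr
  nlinarith [sq_nonneg δ]

/-- Pointwise dyadic majorant of the Poisson kernel. -/
theorem poisson_le_dyadic {E x δ r : ℝ} (hr : 0 < r) (N : ℕ) :
    δ ^ 2 / ((x - E) ^ 2 + δ ^ 2) ≤
      (Set.Ioo (E - r) (E + r)).indicator 1 x +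
      ∑ k ∈ Finset.range N, (δ / (2 ^ k * r)) ^ 2 *
        (Set.Ioo (E - 2 ^ (k + 1) * r) (E + 2 ^ (k + 1) * r)).indicator 1 x +
      (δ / (2 ^ N * r)) ^ 2 := by
  have hind : ∀ ρ : ℝ, 0 ≤ (Set.Ioo (E - ρ) (E + ρ)).indicator (1 : ℝ → ℝ) x := fun ρ =>
    Set.indicator_nonneg (fun _ _ => zero_le_one) x
  have hmem : ∀ ρ : ℝ, |x - E| < ρ → (Set.Ioo (E - ρ) (E + ρ)).indicator (1 : ℝ → ℝ) x = 1 :=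
    fun ρ hρ => by
      rw [abs_lt] at hρ
      have hx : x ∈ Set.Ioo (E - ρ) (E + ρ) := ⟨by linarith, by linarith⟩
      exact Set.indicator_of_mem hx _
  have hterm : ∀ k : ℕ, 0 ≤ (δ / (2 ^ k * r)) ^ 2 *
      (Set.Ioo (E - 2 ^ (k + 1) * r) (E + 2 ^ (k + 1) * r)).indicator (1 : ℝ → ℝ) x :=
    fun k => mul_nonneg (sq_nonneg _) (hind _)
  rcases le_or_gt (2 ^ N * r) |x - E| with hN | hN
  · have := sq_div_add_sq_le (δ := δ) (by positivity) hN
    have := Finset.sum_nonneg fun k (_ : k ∈ Finset.range N) => hterm k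
    linarith [hind r]
  rcases lt_or_ge |x - E| r with hxr | hxr
  · have := sq_div_add_sq_le_one (x - E) δ
    have := Finset.sum_nonneg fun k (_ : k ∈ Finset.range N) => hterm k
    linarith [hmem r hxr, sq_nonneg (δ / (2 ^ N * r))]
  obtain ⟨k, hk1, hk2⟩ := exists_nat_pow_near ((one_le_div hr).2 hxr) (one_lt_two (α := ℝ))
  rw [le_div_iff₀ hr] at hk1
  rw [div_lt_iff₀ hr] at hk2
  have hkN : k < N := by
    have : (2 : ℝ) ^ k < 2 ^ N := lt_of_mul_lt_mul_right (hk1.trans_lt hN) hr.le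
    exact (pow_lt_pow_iff_right₀ one_lt_two).1 this
  have h1 := Finset.single_le_sum (fun k (_ : k ∈ Finset.range N) => hterm k)
    (Finset.mem_range.2 hkN)
  simp only [hmem _ hk2, mul_one] at h1
  have h2 := sq_div_add_sq_le (δ := δ) (by positivity) hk1
  linarith [hind r, sq_nonneg (δ / (2 ^ N * r))]

theorem mul_ImM_le_dyadic (μ : Measure ℝ) [IsFiniteMeasure μ] (E δ : ℝ) {r : ℝ} (hr : 0 < r)
    (N : ℕ) :
    δ * ImM μ E δ ≤ μ.real (Set.Ioo (E - r) (E + r)) +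
      ∑ k ∈ Finset.range N, (δ / (2 ^ k * r)) ^ 2 *
        μ.real (Set.Ioo (E - 2 ^ (k + 1) * r) (E + 2 ^ (k + 1) * r)) +
      (δ / (2 ^ N * r)) ^ 2 * μ.real Set.univ := by
  have hball : ∀ ρ : ℝ, Integrable ((Set.Ioo (E - ρ) (E + ρ)).indicator (1 : ℝ → ℝ)) μ :=
    fun ρ => (integrable_const (1 : ℝ)).indicator measurableSet_Ioo
  have hsum : Integrable (fun x => ∑ k ∈ Finset.range N, (δ / (2 ^ k * r)) ^ 2 *
      (Set.Ioo (E - 2 ^ (k + 1) * r) (E + 2 ^ (k + 1) * r)).indicator (1 : ℝ → ℝ) x) μ :=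
    integrable_finsetSum _ fun k _ => (hball _).const_mul _
  have hkernel : Integrable (fun x => δ ^ 2 / ((x - E) ^ 2 + δ ^ 2)) μ := by
    refine Integrable.of_bound (Measurable.aestronglyMeasurable (by fun_prop)) 1
      (Filter.Eventually.of_forall fun x => ?_)
    rw [Real.norm_of_nonneg (by positivity)]
    exact sq_div_add_sq_le_one _ _
  calc δ * ImM μ E δ = ∫ x, δ ^ 2 / ((x - E) ^ 2 + δ ^ 2) ∂μ := by
        rw [ImM, ← integral_const_mul]
        congr 1 with x
        ring
    _ ≤ _ := integral_mono hkernel (((hball r).add hsum).add (integrable_const _))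
          fun x => poisson_le_dyadic hr N
    _ = _ := by
        rw [integral_add' ((hball r).add hsum) (integrable_const _), integral_add' (hball r) hsum,
          integral_finsetSum _ fun k _ => (hball _).const_mul _]
        simp only [integral_const_mul, integral_indicator_one measurableSet_Ioo, integral_const,
          smul_eq_mul, mul_comm]

end Poisson

theorem two_rpow_three_halves_le : (2 : ℝ) ^ (3 / 2 : ℝ) ≤ 3 := by
  refine (pow_le_pow_iff_left₀ (by positivity) (by norm_num) two_ne_zero).1 ?_
  rw [← Real.rpow_natCast, ← Real.rpow_mul zero_le_two]
  norm_num

theorem sum_three_fourths_pow_le (N : ℕ) :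
    ∑ k ∈ Finset.range N, (3 / 4 : ℝ) ^ k ≤ 4 := by
  rw [geom_sum_eq (by norm_num), div_le_iff_of_neg (by norm_num)]
  have : (0 : ℝ) ≤ (3 / 4) ^ N := by positivity
  linarith

/-- Growth of the mass of the ball of radius `2 ^ k * r` at most like `3 ^ k * A` controls
the Poisson integral. -/
theorem mul_ImM_le_of_growth (μ : Measure ℝ) [IsFiniteMeasure μ] (E δ : ℝ) {r r₀ A : ℝ}
    (hr : 0 < r) (hrr₀ : r ≤ r₀) (hA : 0 ≤ A)
    (hgrowth : ∀ k : ℕ, 2 ^ k * r ≤ r₀ →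
      μ.real (Set.Ioo (E - 2 ^ k * r) (E + 2 ^ k * r)) ≤ 3 ^ k * A) :
    δ * ImM μ E δ ≤ μ.real (Set.Ioo (E - r) (E + r)) + 12 * (δ / r) ^ 2 * A +
      4 / r₀ ^ 2 * δ ^ 2 * μ.real Set.univ := by
  have hr₀ : 0 < r₀ := hr.trans_le hrr₀
  obtain ⟨N, hN1, hN2⟩ := exists_nat_pow_near ((one_le_div hr).2 hrr₀) (one_lt_two (α := ℝ))
  rw [le_div_iff₀ hr] at hN1
  rw [div_lt_iff₀ hr] at hN2
  refine (mul_ImM_le_dyadic μ E δ hr N).trans ?_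
  have hsum : ∑ k ∈ Finset.range N, (δ / (2 ^ k * r)) ^ 2 *
        μ.real (Set.Ioo (E - 2 ^ (k + 1) * r) (E + 2 ^ (k + 1) * r)) ≤
      12 * (δ / r) ^ 2 * A := by
    calc _ ≤ ∑ k ∈ Finset.range N, (3 * (δ / r) ^ 2 * A) * (3 / 4 : ℝ) ^ k := by
          refine Finset.sum_le_sum fun k hk => ?_
          have hkN : (2 : ℝ) ^ (k + 1) * r ≤ r₀ := by
            refine le_trans ?_ hN1
            have := Finset.mem_range.1 hk
            gcongr
            · norm_num
            · omega
          refine (mul_le_mul_of_nonneg_left (hgrowth _ hkN) (sq_nonneg _)).trans_eq ?_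
          rw [div_pow (3 : ℝ), show (4 : ℝ) = 2 ^ 2 by norm_num, ← pow_mul, mul_comm 2 k, pow_mul]
          field_simp
          ring
      _ ≤ (3 * (δ / r) ^ 2 * A) * 4 := by
          rw [← Finset.mul_sum]
          have := sum_three_fourths_pow_le N
          gcongr
      _ = _ := by ring
  have htail : (δ / (2 ^ N * r)) ^ 2 * μ.real Set.univ ≤
      4 / r₀ ^ 2 * δ ^ 2 * μ.real Set.univ := by
    gcongr
    rw [div_pow, div_mul_eq_mul_div, div_le_div_iff₀ (by positivity) (by positivity)]
    have : r₀ ^ 2 ≤ (2 * (2 ^ N * r)) ^ 2 := by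
      gcongr
      rw [pow_succ] at hN2
      linarith
    nlinarith [sq_nonneg δ]
  linarith

/-- Since `ϵ ^ f ϵ = 1 / x`, this bounds the growth of `1 / x` by that of `ϵ ^ (3 / 2)`. -/
theorem rpow_exponent_growth {h γ₀ ε : ℝ} {nseq η : ℕ → ℝ} {ψ f : ℝ → ℝ}
    (hh : 0 < h) (hε : 0 < ε) (hε1 : ε < 1)
    (hW : WindowData h γ₀ ε nseq η) (hψ : IsResonanceExponent h nseq η ψ)
    (hf : ∀ x : ℝ, Real.exp (h * nseq 1) ≤ x → f (x ^ (-(ψ x) / 2)) = 2 / ψ x)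
    {r R : ℝ} (hr : 0 < r) (hrR : r ≤ R)
    (hR : R ≤ Real.exp (h * nseq 1) ^ (-(ψ (Real.exp (h * nseq 1))) / 2)) :
    f r ≤ 1 ∧ R ^ f R ≤ (R / r) ^ (3 / 2 : ℝ) * r ^ f r := by
  obtain ⟨hlow, hup⟩ := logScale_Ici hh hε hε1 hW hψ
  have hparam : ∀ ρ : ℝ, 0 < ρ →
      ρ ≤ Real.exp (h * nseq 1) ^ (-(ψ (Real.exp (h * nseq 1))) / 2) →
      ∃ L, h * nseq 1 ≤ L ∧ ρ = Real.exp (-logScale ψ L) ∧ f ρ ≤ 1 ∧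
        ρ ^ f ρ = Real.exp (-L) := by
    intro ρ hρ hρ1
    rw [exp_rpow_neg_half, ← Real.log_le_iff_le_exp hρ] at hρ1
    obtain ⟨L, hL, hLρ⟩ := exists_eq_of_slope_bounds (y := -Real.log ρ) hlow hup (by linarith)
    have hρL : ρ = Real.exp (-logScale ψ L) := by rw [hLρ, neg_neg, Real.exp_log hρ]
    have hψL := (hψ.1 (Real.exp L) (Real.exp_le_exp.2 hL)).1
    have hfL := hf (Real.exp L) (Real.exp_le_exp.2 hL)
    rw [exp_rpow_neg_half, ← hρL] at hfL
    refine ⟨L, hL, hρL, ?_, ?_⟩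
    · rw [hfL]
      exact div_le_one_of_le₀ hψL (by linarith)
    · rw [hfL, hρL, ← Real.exp_mul, logScale]
      congr 1
      field_simp
  obtain ⟨a, ha, hRa, -, hRf⟩ := hparam R (hr.trans_le hrR) hR
  obtain ⟨b, hb, hrb, hf1, hrf⟩ := hparam r hr (hrR.trans hR)
  refine ⟨hf1, ?_⟩
  have hG : logScale ψ a ≤ logScale ψ b := by
    rw [hRa, hrb, Real.exp_le_exp] at hrR
    linarith
  rw [hRf, hrf, hRa, hrb, ← Real.exp_sub, ← Real.exp_mul, ← Real.exp_add, Real.exp_le_exp]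
  rcases le_total a b with hab | hab
  · have := hlow ha hb hab
    simp only at this
    linarith
  · linarith

/-- the dislocation lower bound (Lemma `mu2`): if
`µ((E−ϵ', E+ϵ')) ≤ ϵ'^{f(ϵ') − C̃ε}` for small `ϵ'`, then
`µ((E−ϵ, E+ϵ)) ≥ ϵ^{1+τ}·Im M(E + iϵ^{1+τ}) − C·ϵ^{f(ϵ) + 2τ − 3C̃ε}`. -/
theorem dislocation_lower_bound :
    ∃ c₀ > (0 : ℝ), ∀ (h γ₀ ε : ℝ) (nseq η : ℕ → ℝ) (ψ : ℝ → ℝ),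
      0 < h → 0 < ε → ε < c₀ * min 1 h →
      WindowData h γ₀ ε nseq η →
      IsResonanceExponent h nseq η ψ →
      ∀ f : ℝ → ℝ,
        (∀ x : ℝ, Real.exp (h * nseq 1) ≤ x → f (x ^ (-(ψ x) / 2)) = 2 / ψ x) →
      ∀ (μ : Measure ℝ), IsFiniteMeasure μ → ∀ (E : ℝ) (Ctil : ℝ), 1 ≤ Ctil →
      ∀ ε₀ : ℝ, 0 < ε₀ →
        ε₀ ≤ Real.exp (h * nseq 1) ^ (-(ψ (Real.exp (h * nseq 1))) / 2) →
        (∀ ϵ' : ℝ, 0 < ϵ' → ϵ' ≤ ε₀ →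
          (μ (Set.Ioo (E - ϵ') (E + ϵ'))).toReal ≤ ϵ' ^ (f ϵ' - Ctil * ε)) →
        ∃ εstar > (0 : ℝ), ∃ C > (0 : ℝ), ∀ ϵ : ℝ, 0 < ϵ → ϵ ≤ εstar →
          ∀ τ : ℝ, 0 ≤ τ →
            ϵ ^ (1 + τ) * ImM μ E (ϵ ^ (1 + τ)) - C * ϵ ^ (f ϵ + 2 * τ - 3 * Ctil * ε) ≤
              (μ (Set.Ioo (E - ϵ) (E + ϵ))).toReal := by
  refine ⟨1, one_pos, ?_⟩
  intro h γ₀ ε nseq η ψ hh hε hεc hW hψ f hf μ hμ E Ctil hCtil ε₀ hε₀ hε₀le hball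
  have hε1 : ε < 1 := by
    rw [one_mul] at hεc
    exact hεc.trans_le (min_le_left _ _)
  have hCε : 0 ≤ Ctil * ε := by positivity
  have hε₀1 : ε₀ ≤ 1 := by
    refine hε₀le.trans (Real.rpow_le_one_of_one_le_of_nonpos ?_ ?_)
    · exact Real.one_le_exp (mul_pos hh (hW.2.2.2.1 1)).le
    · linarith [(hψ.1 _ le_rfl).1]
  refine ⟨ε₀, hε₀, 12 + 4 / ε₀ ^ 2 * μ.real Set.univ, by positivity, ?_⟩
  intro r hr hrε₀ τ hτ
  have hr1 : r ≤ 1 := hrε₀.trans hε₀1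
  have hf1 : f r ≤ 1 := (rpow_exponent_growth hh hε hε1 hW hψ hf hr le_rfl (hrε₀.trans hε₀le)).1
  have hgrowth : ∀ k : ℕ, 2 ^ k * r ≤ ε₀ →
      μ.real (Set.Ioo (E - 2 ^ k * r) (E + 2 ^ k * r)) ≤ 3 ^ k * r ^ (f r - 3 * Ctil * ε) := by
    intro k hk
    have hrR : r ≤ 2 ^ k * r := le_mul_of_one_le_left hr.le (one_le_pow₀ one_le_two)
    have hR : 0 < 2 ^ k * r := by positivity
    have hg := (rpow_exponent_growth hh hε hε1 hW hψ hf hr hrR (hk.trans hε₀le)).2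
    have h3 : (2 ^ k * r / r) ^ (3 / 2 : ℝ) ≤ 3 ^ k := by
      rw [mul_div_cancel_right₀ _ hr.ne', ← Real.rpow_natCast 2 k, ← Real.rpow_mul zero_le_two,
        mul_comm, Real.rpow_mul zero_le_two, Real.rpow_natCast]
      gcongr
      exact two_rpow_three_halves_le
    calc μ.real (Set.Ioo (E - 2 ^ k * r) (E + 2 ^ k * r))
        ≤ (2 ^ k * r) ^ (f (2 ^ k * r) - Ctil * ε) := hball _ hR hk
      _ = (2 ^ k * r) ^ f (2 ^ k * r) * (2 ^ k * r) ^ (-(Ctil * ε)) := by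
          rw [← Real.rpow_add hR, sub_eq_add_neg]
      _ ≤ (3 ^ k * r ^ f r) * r ^ (-(3 * Ctil * ε)) := by
          gcongr ?_ * ?_
          · exact hg.trans (by gcongr)
          · refine (Real.rpow_le_rpow_of_nonpos hr hrR (by linarith)).trans ?_
            exact Real.rpow_le_rpow_of_exponent_ge hr hr1 (by linarith)
      _ = 3 ^ k * r ^ (f r - 3 * Ctil * ε) := by
          rw [sub_eq_add_neg, Real.rpow_add hr, mul_assoc]
  have hmain := mul_ImM_le_of_growth μ E (r ^ (1 + τ)) hr hrε₀ (by positivity) hgrowth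
  have hδ : (r ^ (1 + τ) / r) ^ 2 * r ^ (f r - 3 * Ctil * ε) =
      r ^ (f r + 2 * τ - 3 * Ctil * ε) := by
    rw [Real.rpow_add hr, Real.rpow_one, mul_div_cancel_left₀ _ hr.ne', ← Real.rpow_natCast,
      ← Real.rpow_mul hr.le, ← Real.rpow_add hr]
    push_cast
    ring_nf
  have hδ2 : (r ^ (1 + τ)) ^ 2 ≤ r ^ (f r + 2 * τ - 3 * Ctil * ε) := by
    rw [← Real.rpow_natCast, ← Real.rpow_mul hr.le]
    refine Real.rpow_le_rpow_of_exponent_ge hr hr1 ?_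
    push_cast
    linarith
  rw [mul_assoc 12, hδ] at hmain
  have htail := mul_le_mul_of_nonneg_left hδ2
    (show 0 ≤ 4 / ε₀ ^ 2 * μ.real Set.univ by positivity)
  change _ ≤ μ.real (Set.Ioo (E - r) (E + r))
  linarith
end
end

section
/- Let d ≥ 1, γ > 0, τ > 0, and let α ∈ ℝ^d satisfy ‖⟨n, α⟩‖_{ℝ/ℤ} ≥ γ|n|^{−τ} for all n ∈ ℤ^d∖{0}. Let ε₀ > 0, θ ∈ ℝ, and let n₁ ≠ n₂ ∈ ℤ^d satisfy ‖θ − ⟨nᵢ, α⟩‖_{ℝ/ℤ} ≤ e^{−ε₀|nᵢ|} for i = 1, 2, with |n₁| ≤ |n₂|. Then |n₂| ≥ (γ/2)^{1/τ}·e^{ε₀|n₁|/τ} − |n₁|. In particular, for Diophantine α consecutive ε₀-resonances of θ are exponentially repelled. -/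
noncomputable section

/-- Distance from a real number to the nearest integer, `‖x‖_{ℝ/ℤ}`. -/
def distZ (x : ℝ) : ℝ := |x - round x|

/-- Standard dot product `⟨n, α⟩` of an integer vector with a real vector. -/
def intDot {d : ℕ} (n : Fin d → ℤ) (α : Fin d → ℝ) : ℝ := ∑ i, (n i : ℝ) * α i

/-- Sup-norm `|n|` of an integer vector, as a real number. -/
def intVecNorm {d : ℕ} (n : Fin d → ℤ) : ℝ := ((Finset.univ.sup fun i => (n i).natAbs : ℕ) : ℝ)

theorem distZ_le_abs_sub_intCast (x : ℝ) (k : ℤ) : distZ x ≤ |x - k| :=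
  round_le x k

theorem distZ_sub_le (x y : ℝ) : distZ (x - y) ≤ distZ x + distZ y := by
  calc distZ (x - y) ≤ |x - y - ((round x - round y : ℤ) : ℝ)| := distZ_le_abs_sub_intCast _ _
    _ = |(x - round x) - (y - round y)| := by push_cast; ring_nf
    _ ≤ distZ x + distZ y := abs_sub _ _

theorem intDot_sub {d : ℕ} (m n : Fin d → ℤ) (α : Fin d → ℝ) :
    intDot (m - n) α = intDot m α - intDot n α := by
  simp [intDot, sub_mul, Finset.sum_sub_distrib]

theorem intVecNorm_pos {d : ℕ} {n : Fin d → ℤ} (hn : n ≠ 0) : 0 < intVecNorm n := by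
  obtain ⟨i, hi⟩ := Function.ne_iff.mp hn
  exact Nat.cast_pos.mpr ((Int.natAbs_pos.mpr hi).trans_le
    (Finset.le_sup (f := fun i => (n i).natAbs) (Finset.mem_univ i)))

theorem intVecNorm_sub_le {d : ℕ} (m n : Fin d → ℤ) :
    intVecNorm (m - n) ≤ intVecNorm m + intVecNorm n := by
  unfold intVecNorm
  rw [← Nat.cast_add, Nat.cast_le]
  refine Finset.sup_le fun i hi => (Int.natAbs_sub_le (m i) (n i)).trans (add_le_add ?_ ?_)
  · exact Finset.le_sup (f := fun i => (m i).natAbs) hi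
  · exact Finset.le_sup (f := fun i => (n i).natAbs) hi

/-- exponential repulsion of consecutive `ε₀`-resonances for
Diophantine frequencies. -/
theorem exp_repulsion_of_resonances
    (d : ℕ) (hd : 1 ≤ d) (γ τ : ℝ) (hγ : 0 < γ) (hτ : 0 < τ)
    (α : Fin d → ℝ)
    (hdio : ∀ n : Fin d → ℤ, n ≠ 0 → γ * intVecNorm n ^ (-τ) ≤ distZ (intDot n α))
    (ε₀ : ℝ) (hε₀ : 0 < ε₀) (θ : ℝ)
    (n₁ n₂ : Fin d → ℤ) (hne : n₁ ≠ n₂)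
    (h₁ : distZ (θ - intDot n₁ α) ≤ Real.exp (-ε₀ * intVecNorm n₁))
    (h₂ : distZ (θ - intDot n₂ α) ≤ Real.exp (-ε₀ * intVecNorm n₂))
    (hle : intVecNorm n₁ ≤ intVecNorm n₂) :
    (γ / 2) ^ (1 / τ) * Real.exp (ε₀ * intVecNorm n₁ / τ) - intVecNorm n₁ ≤ intVecNorm n₂ := by
  have hM : 0 < intVecNorm (n₁ - n₂) := intVecNorm_pos (sub_ne_zero.mpr hne)
  have hexp : Real.exp (-ε₀ * intVecNorm n₂) ≤ Real.exp (-ε₀ * intVecNorm n₁) :=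
    Real.exp_le_exp.mpr (mul_le_mul_of_nonpos_left hle (neg_nonpos.mpr hε₀.le))
  have hdist : distZ (intDot (n₁ - n₂) α) ≤ 2 * Real.exp (-ε₀ * intVecNorm n₁) := by
    have h := distZ_sub_le (θ - intDot n₂ α) (θ - intDot n₁ α)
    rw [sub_sub_sub_cancel_left, ← intDot_sub] at h
    linarith
  have hsmall := (hdio _ (sub_ne_zero.mpr hne)).trans hdist
  have hpow : γ / 2 * Real.exp (ε₀ * intVecNorm n₁) ≤ intVecNorm (n₁ - n₂) ^ τ := by
    rw [Real.rpow_neg hM.le, neg_mul, Real.exp_neg, ← div_eq_mul_inv, ← div_eq_mul_inv,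
      div_le_div_iff₀ (Real.rpow_pos_of_pos hM τ) (Real.exp_pos _)] at hsmall
    linarith
  have hroot := Real.rpow_le_rpow (by positivity) hpow (one_div_nonneg.mpr hτ.le)
  rw [Real.mul_rpow (by positivity) (Real.exp_pos _).le, ← Real.exp_mul, mul_one_div,
    ← Real.rpow_mul hM.le, mul_one_div_cancel hτ.ne', Real.rpow_one] at hroot
  linarith [intVecNorm_sub_le n₁ n₂]
end
end
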